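/- Let n ≥ 3 and 1 ≤ p < ∞. If Φ : P_o^n → C_p(ℝ^n) is an SL(n) covariant valuation, then there exist constants a₁, a₂, b₁, b₂ ∈ ℝ such that Φ(P) = Φ_{p;a₁,a₂}(P) + Φ_{p;b₁,b₂}(−P) for every P ∈ P_o^n with dim P ≤ n − 1. -/

import Mathlib

open scoped RealInnerProductSpace BigOperators Pointwise ENNReal
open MeasureTheory Filter Matrix

noncomputable section

/-- `Euc n` is Euclidean space `ℝ^n`. -/
abbrev Euc (n : ℕ) := EuclideanSpace ℝ (Fin n)

/-- A convex body in `ℝ^n` containing the origin: a nonempty compact convex set with `0 ∈ K`. -/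
def IsConvexBody0 {n : ℕ} (K : Set (Euc n)) : Prop :=
  IsCompact K ∧ Convex ℝ K ∧ (0 : Euc n) ∈ K

/-- A convex polytope in `ℝ^n` containing the origin. -/
def IsPolytope0 {n : ℕ} (P : Set (Euc n)) : Prop :=
  (∃ S : Finset (Euc n), P = convexHull ℝ (S : Set (Euc n))) ∧ (0 : Euc n) ∈ P

/-- The support function `h_K(x) = sup { ⟪x, y⟫ : y ∈ K }`. -/
def supp {n : ℕ} (K : Set (Euc n)) (x : Euc n) : ℝ :=
  sSup ((fun y => ⟪x, y⟫) '' K)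

/-- The image of a set under the linear map induced by a matrix. -/
def matAct {n : ℕ} (A : Matrix (Fin n) (Fin n) ℝ) (K : Set (Euc n)) : Set (Euc n) :=
  (Matrix.toEuclideanLin A) '' K

/-- The vector `A x`. -/
def matVec {n : ℕ} (A : Matrix (Fin n) (Fin n) ℝ) (x : Euc n) : Euc n :=
  Matrix.toEuclideanLin A x

/-- The dimension of a set: the dimension of (the direction of) its affine hull. -/
def sdim {n : ℕ} (P : Set (Euc n)) : ℕ :=
  Module.finrank ℝ (affineSpan ℝ P).direction

/-- The set of `j`-dimensional faces of `P` containing the origin (faces of a polytope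
being exactly its exposed faces). -/
def facesO {n : ℕ} (j : ℕ) (P : Set (Euc n)) : Set (Set (Euc n)) :=
  {F | IsExposed ℝ P F ∧ sdim F = j ∧ (0 : Euc n) ∈ F}

/-- The function-valued valuation `Φ_{p;a₁,a₂}`:
`Φ_{p;a₁,a₂}(P) = a₁ h_P^p + (a₂-a₁) Σ_{1≤j≤dim P-1} (-1)^j Σ_{F ∈ F_{j,o}(P)} h_F^p` if `dim P` is
odd, and with leading coefficient `2a₂ - a₁` instead of `a₁` if `dim P` is even. -/
def PhiP {n : ℕ} (p a₁ a₂ : ℝ) (P : Set (Euc n)) : Euc n → ℝ := fun x =>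
  (if Odd (sdim P) then a₁ else 2 * a₂ - a₁) * supp P x ^ p
    + (a₂ - a₁) * ∑ j ∈ Finset.Icc 1 (sdim P - 1),
        (-1 : ℝ) ^ j * ∑ᶠ F ∈ facesO j P, supp F x ^ p

/-- The exposed faces of `P` containing the origin, of any dimension. -/
def originFaces {n : ℕ} (P : Set (Euc n)) : Set (Set (Euc n)) :=
  {F | IsExposed ℝ P F ∧ (0 : Euc n) ∈ F}

theorem mem_originFaces {n : ℕ} {P F : Set (Euc n)} (h0 : (0 : Euc n) ∈ P) :
    F ∈ originFaces P ↔
      ∃ g : Euc n →ₗ[ℝ] ℝ, (∀ y ∈ P, g y ≤ 0) ∧ F = {y ∈ P | g y = 0} := by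
  constructor
  · rintro ⟨hF, hF0⟩
    obtain ⟨l, hl⟩ := hF ⟨0, hF0⟩
    have h1 : ∀ y ∈ P, l y ≤ 0 := by
      have := hl ▸ hF0
      intro y hy
      simpa using this.2 y hy
    refine ⟨l.toLinearMap, h1, ?_⟩
    rw [hl]
    ext y
    simp only [Set.mem_ofPred_eq]
    refine and_congr_right fun hy => ⟨fun h => ?_, fun h z hz => ?_⟩
    · have := h 0 h0
      rw [map_zero] at this
      exact le_antisymm (h1 y hy) this
    · have h' : l y = 0 := h
      rw [h']
      exact h1 z hz
  · rintro ⟨g, hg, rfl⟩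
    refine ⟨fun _ => ⟨LinearMap.toContinuousLinearMap g, ?_⟩, h0, map_zero g⟩
    ext y
    simp only [Set.mem_ofPred_eq, LinearMap.coe_toContinuousLinearMap']
    refine and_congr_right fun hy => ⟨fun h z hz => ?_, fun h => ?_⟩
    · rw [h]
      exact hg z hz
    · have := h 0 h0
      rw [map_zero] at this
      exact le_antisymm (hg y hy) this

theorem originFaces_finite {n : ℕ} {P : Set (Euc n)} (hP : IsPolytope0 P) :
    (originFaces P).Finite := by
  obtain ⟨⟨S, hS⟩, h0⟩ := hP
  have key : ∀ F ∈ originFaces P, F = convexHull ℝ (F ∩ (S : Set (Euc n))) := by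
    rintro F ⟨hF, hF0⟩
    have hPc : IsCompact P := hS ▸ S.finite_toSet.isCompact_convexHull ℝ
    have hPconv : Convex ℝ P := hS ▸ convex_convexHull ℝ _
    have hFc := hF.isCompact hPc
    have hFconv := hF.convex hPconv
    apply Set.Subset.antisymm
    · have h1 := closure_convexHull_extremePoints hFc hFconv
      have h2 : F.extremePoints ℝ ⊆ F ∩ (S : Set (Euc n)) := by
        intro y hy
        refine ⟨hy.1, ?_⟩
        have h3 := hF.isExtreme.extremePoints_subset_extremePoints hy
        rw [hS] at h3
        exact extremePoints_convexHull_subset h3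
      calc F = closure (convexHull ℝ (F.extremePoints ℝ)) := h1.symm
        _ ⊆ closure (convexHull ℝ (F ∩ (S : Set (Euc n)))) :=
            closure_mono (convexHull_mono h2)
        _ = convexHull ℝ (F ∩ (S : Set (Euc n))) :=
            (((S.finite_toSet.inter_of_right F).isCompact_convexHull ℝ).isClosed).closure_eq
    · exact convexHull_min Set.inter_subset_left hFconv
  refine ((S.finite_toSet.finite_subsets).image (fun A => convexHull ℝ A)).subset ?_
  intro F hF
  exact ⟨F ∩ S, Set.inter_subset_right, (key F hF).symm⟩

theorem IsPolytope0.isCompact {n : ℕ} {P : Set (Euc n)} (hP : IsPolytope0 P) : IsCompact P := by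
  obtain ⟨⟨S, hS⟩, -⟩ := hP
  exact hS ▸ S.finite_toSet.isCompact_convexHull ℝ

theorem IsPolytope0.convex {n : ℕ} {P : Set (Euc n)} (hP : IsPolytope0 P) : Convex ℝ P := by
  obtain ⟨⟨S, hS⟩, -⟩ := hP
  exact hS ▸ convex_convexHull ℝ _

theorem IsPolytope0.zero_mem {n : ℕ} {P : Set (Euc n)} (hP : IsPolytope0 P) : 0 ∈ P := hP.2

theorem sdim_eq_finrank_span {n : ℕ} {P : Set (Euc n)} (h0 : (0 : Euc n) ∈ P) :
    sdim P = Module.finrank ℝ (Submodule.span ℝ P) := by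
  rw [sdim, direction_affineSpan, vectorSpan_eq_span_vsub_set_right ℝ h0]
  have h : (fun x : Euc n => x -ᵥ 0) '' P = P := by
    ext y
    simp
  rw [h]

/-- The part of a convex set in an open half-space reaches the bounding hyperplane towards any
point on the other side. -/
theorem exists_mem_hyperplane {E : Type*} [AddCommGroup E] [Module ℝ E] {F : Set E}
    (hF : Convex ℝ F) (l : E →ₗ[ℝ] ℝ) {y z : E} (hy : y ∈ F) (hz : z ∈ F) (hly : 0 < l y)
    (hlz : l z < 0) :
    ∃ a b : ℝ, 0 < a ∧ 0 < b ∧ a + b = 1 ∧ a • y + b • z ∈ F ∧ l (a • y + b • z) = 0 := by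
  have hd : 0 < l y - l z := by linarith
  refine ⟨-l z / (l y - l z), l y / (l y - l z), by apply div_pos <;> linarith,
    by positivity, by field_simp; ring, ?_, ?_⟩
  · exact hF hy hz (by apply le_of_lt; apply div_pos <;> linarith) (by positivity)
      (by field_simp; ring)
  · simp only [map_add, map_smul, smul_eq_mul]
    field_simp
    ring

theorem exists_nonpos_add_smul {E : Type*} [AddCommGroup E] [Module ℝ E] {P : Set E}
    (hP : Convex ℝ P) (l g : E →ₗ[ℝ] ℝ) (hpos : ∃ y ∈ P, 0 < l y) (hneg : ∃ y ∈ P, l y < 0)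
    (hg : ∀ y ∈ P, l y = 0 → g y ≤ 0) : ∃ c : ℝ, ∀ y ∈ P, g y + c * l y ≤ 0 := by
  set A : Set ℝ := (fun z => g z / (-l z)) '' {z ∈ P | l z < 0} with hA
  have key : ∀ y ∈ P, 0 < l y → ∀ a ∈ A, a ≤ -g y / l y := by
    rintro y hy hly _ ⟨z, ⟨hz, hlz⟩, rfl⟩
    obtain ⟨a, b, ha, hb, hab, hm, hl0⟩ := exists_mem_hyperplane hP l hy hz hly hlz
    have h1 := hg _ hm hl0
    simp only [map_add, map_smul, smul_eq_mul] at h1 hl0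
    simp only
    rw [div_le_div_iff₀ (by linarith) hly]
    have : b * (g z * l y - -g y * -l z) ≤ 0 := by
      have e : b * (g z * l y - -g y * -l z) = l y * (a * g y + b * g z)
        - g y * (a * l y + b * l z) := by ring
      rw [e, hl0]
      nlinarith
    nlinarith
  obtain ⟨y0, hy0, hly0⟩ := hpos
  obtain ⟨z0, hz0, hlz0⟩ := hneg
  have hbdd : BddAbove A := ⟨_, fun a ha => key y0 hy0 hly0 a ha⟩
  have hne : A.Nonempty := ⟨_, z0, ⟨hz0, hlz0⟩, rfl⟩
  refine ⟨sSup A, fun y hy => ?_⟩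
  rcases lt_trichotomy (l y) 0 with h | h | h
  · have h1 : g y / (-l y) ≤ sSup A := le_csSup hbdd ⟨y, ⟨hy, h⟩, rfl⟩
    rw [div_le_iff₀ (by linarith)] at h1
    linarith
  · rw [h, mul_zero, add_zero]
    exact hg y hy h
  · have h1 : sSup A ≤ -g y / l y := csSup_le hne (key y hy h)
    rw [le_div_iff₀ h] at h1
    linarith

theorem inter_mem_originFaces {n : ℕ} {P F C : Set (Euc n)} (h0 : (0 : Euc n) ∈ P)
    (hC : (0 : Euc n) ∈ C) (hF : F ∈ originFaces P) : F ∩ C ∈ originFaces (P ∩ C) := by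
  obtain ⟨g, hg, rfl⟩ := (mem_originFaces h0).1 hF
  refine (mem_originFaces (P := P ∩ C) ⟨h0, hC⟩).2 ⟨g, fun y hy => hg y hy.1, ?_⟩
  ext y
  simp only [Set.mem_inter_iff, Set.mem_ofPred_eq]
  tauto

section Cut

variable {n : ℕ} {P : Set (Euc n)} (l : Euc n →ₗ[ℝ] ℝ)

theorem exists_originFaces_of_hyperplane (h0 : (0 : Euc n) ∈ P) (hP : Convex ℝ P)
    (hpos : ∃ y ∈ P, 0 < l y) (hneg : ∃ y ∈ P, l y < 0) {G : Set (Euc n)}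
    (hG : G ∈ originFaces (P ∩ {y | l y = 0})) :
    ∃ F ∈ originFaces P, F ∩ {y | l y = 0} = G := by
  obtain ⟨g, hg, rfl⟩ := (mem_originFaces (P := P ∩ {y | l y = 0}) ⟨h0, map_zero l⟩).1 hG
  obtain ⟨c, hc⟩ := exists_nonpos_add_smul hP l g hpos hneg fun y hy hl => hg y ⟨hy, hl⟩
  refine ⟨_, (mem_originFaces h0).2 ⟨g + c • l, hc, rfl⟩, ?_⟩
  ext y
  simp only [Set.mem_inter_iff, Set.mem_ofPred_eq, LinearMap.add_apply, LinearMap.smul_apply,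
    smul_eq_mul]
  constructor
  · rintro ⟨⟨h1, h2⟩, h3⟩
    rw [h3] at h2
    exact ⟨⟨h1, h3⟩, by linarith⟩
  · rintro ⟨⟨h1, h2⟩, h3⟩
    exact ⟨⟨h1, by rw [h2, h3]; ring⟩, h2⟩

theorem originFaces_hyperplane_subset (h0 : (0 : Euc n) ∈ P) (hP : Convex ℝ P)
    (hpos : ∃ y ∈ P, 0 < l y) (hneg : ∃ y ∈ P, l y < 0) :
    originFaces (P ∩ {y | l y = 0}) ⊆ originFaces (P ∩ {y | 0 ≤ l y}) := by
  intro G hG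
  obtain ⟨F, hF, rfl⟩ := exists_originFaces_of_hyperplane l h0 hP hpos hneg hG
  obtain ⟨g, hg, rfl⟩ := (mem_originFaces h0).1 hF
  refine (mem_originFaces (P := P ∩ {y | 0 ≤ l y}) ⟨h0, (map_zero l).ge⟩).2 ⟨g - l, ?_, ?_⟩
  · rintro y ⟨hy, hl⟩
    have := hg y hy
    have hl' : 0 ≤ l y := hl
    simp only [LinearMap.sub_apply]
    linarith
  · ext y
    simp only [Set.mem_inter_iff, Set.mem_ofPred_eq, LinearMap.sub_apply]
    constructor
    · rintro ⟨⟨h1, h2⟩, h3⟩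
      exact ⟨⟨h1, h3.ge⟩, by rw [h2, h3]; ring⟩
    · rintro ⟨⟨h1, h2⟩, h3⟩
      have := hg y h1
      exact ⟨⟨h1, by linarith⟩, by linarith⟩

theorem mem_originFaces_halfspace (h0 : (0 : Euc n) ∈ P) (hP : Convex ℝ P)
    (hpos : ∃ y ∈ P, 0 < l y) (hneg : ∃ y ∈ P, l y < 0) {G : Set (Euc n)}
    (hG : G ∈ originFaces (P ∩ {y | 0 ≤ l y})) :
    G ∈ originFaces (P ∩ {y | l y = 0}) ∨
      ∃ F ∈ originFaces P, (∃ y ∈ F, 0 < l y) ∧ F ∩ {y | 0 ≤ l y} = G := by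
  obtain ⟨g, hg, rfl⟩ := (mem_originFaces (P := P ∩ {y | 0 ≤ l y}) ⟨h0, (map_zero l).ge⟩).1 hG
  by_cases h : ∃ z ∈ P, 0 < l z ∧ g z = 0
  · right
    obtain ⟨z, hz, hlz, hgz⟩ := h
    obtain ⟨c, hc⟩ := exists_nonpos_add_smul hP l g hpos hneg fun y hy hl => hg y ⟨hy, hl.ge⟩
    have hc0 : c ≤ 0 := by
      have := hc z hz
      rw [hgz, zero_add] at this
      by_contra hcon
      push Not at hcon
      have := mul_pos hcon hlz
      linarith
    refine ⟨_, (mem_originFaces h0).2 ⟨g, fun y hy => ?_, rfl⟩, ⟨z, ⟨hz, hgz⟩, hlz⟩, ?_⟩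
    · rcases le_or_gt 0 (l y) with hl | hl
      · exact hg y ⟨hy, hl⟩
      · have := hc y hy
        nlinarith [mul_nonneg_of_nonpos_of_nonpos hc0 hl.le]
    · ext y
      simp only [Set.mem_inter_iff, Set.mem_ofPred_eq]
      tauto
  · left
    push Not at h
    refine (mem_originFaces (P := P ∩ {y | l y = 0}) ⟨h0, map_zero l⟩).2
      ⟨g, fun y hy => hg y ⟨hy.1, hy.2.ge⟩, ?_⟩
    ext y
    simp only [Set.mem_inter_iff, Set.mem_ofPred_eq]
    constructor
    · rintro ⟨⟨h1, h2⟩, h3⟩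
      refine ⟨⟨h1, ?_⟩, h3⟩
      by_contra hne
      exact h y h1 (lt_of_le_of_ne h2 (Ne.symm hne)) h3
    · rintro ⟨⟨h1, h2⟩, h3⟩
      exact ⟨⟨h1, h2.ge⟩, h3⟩

theorem subset_of_inter_hyperplane_subset (h0 : (0 : Euc n) ∈ P) (hP : Convex ℝ P)
    {F G : Set (Euc n)} (hF : F ∈ originFaces P) (hG : G ∈ originFaces P)
    (hpos : ∃ y ∈ F, 0 < l y) (hneg : ∃ y ∈ F, l y < 0) (h : F ∩ {y | l y = 0} ⊆ G) :
    F ⊆ G := by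
  have hFc : Convex ℝ F := hF.1.convex hP
  have hFP : F ⊆ P := hF.1.subset
  obtain ⟨g, hg, rfl⟩ := (mem_originFaces h0).1 hG
  have key : ∀ y ∈ F, ∀ z ∈ F, 0 < l y → l z < 0 → g y = 0 ∧ g z = 0 := by
    intro y hy z hz hly hlz
    obtain ⟨a, b, ha, hb, hab, hm, hl0⟩ := exists_mem_hyperplane hFc l hy hz hly hlz
    have h1 := (h ⟨hm, hl0⟩).2
    simp only [map_add, map_smul, smul_eq_mul] at h1
    have h2 := hg y (hFP hy)
    have h3 := hg z (hFP hz)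
    have h4 := mul_nonpos_of_nonneg_of_nonpos ha.le h2
    have h5 := mul_nonpos_of_nonneg_of_nonpos hb.le h3
    constructor
    · have : a * g y = 0 := by linarith
      exact (mul_eq_zero.1 this).resolve_left ha.ne'
    · have : b * g z = 0 := by linarith
      exact (mul_eq_zero.1 this).resolve_left hb.ne'
  obtain ⟨y0, hy0, hly0⟩ := hpos
  obtain ⟨z0, hz0, hlz0⟩ := hneg
  intro y hy
  rcases lt_trichotomy (l y) 0 with hl | hl | hl
  · exact ⟨hFP hy, (key y0 hy0 y hy hly0 hl).2⟩
  · exact h ⟨hy, hl⟩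
  · exact ⟨hFP hy, (key y hy z0 hz0 hl hlz0).1⟩

theorem inter_hyperplane_mem_originFaces (hP : IsPolytope0 P) {F : Set (Euc n)}
    (hF : F ∈ originFaces P) (hnn : ∀ y ∈ F, 0 ≤ l y) :
    F ∩ {y | l y = 0} ∈ originFaces P := by
  obtain ⟨g, hg, rfl⟩ := (mem_originFaces hP.zero_mem).1 hF
  obtain ⟨S, hS⟩ := hP.1
  have hSP : ∀ s ∈ S, s ∈ P := fun s hs => hS ▸ subset_convexHull ℝ _ hs
  have h1 : ∀ s ∈ S, ∀ᶠ M : ℝ in atTop, M * g s - l s ≤ 0 := by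
    intro s hs
    rcases (hg s (hSP s hs)).lt_or_eq with h | h
    · filter_upwards [eventually_ge_atTop (l s / g s)] with M hM
      rw [div_le_iff_of_neg h] at hM
      linarith
    · refine Eventually.of_forall fun M => ?_
      have := hnn s ⟨hSP s hs, h⟩
      rw [h]
      linarith
  obtain ⟨M, hM⟩ := ((Filter.eventually_all_finset S).2 h1).exists
  have hMP : ∀ y ∈ P, M * g y - l y ≤ 0 := by
    have : P ⊆ {y | (M • g - l) y ≤ 0} := by
      rw [hS]
      exact convexHull_min (fun s hs => hM s hs)
        (convex_halfSpace_le (M • g - l).isLinear 0)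
    exact fun y hy => this hy
  refine (mem_originFaces hP.zero_mem).2 ⟨M • g - l + g, fun y hy => ?_, ?_⟩
  · have h2 := hMP y hy
    have h3 := hg y hy
    simp only [LinearMap.add_apply, LinearMap.sub_apply, LinearMap.smul_apply, smul_eq_mul]
    linarith
  · ext y
    simp only [Set.mem_inter_iff, Set.mem_ofPred_eq, LinearMap.add_apply, LinearMap.sub_apply,
      LinearMap.smul_apply, smul_eq_mul]
    constructor
    · rintro ⟨⟨h1, h2⟩, h3⟩
      exact ⟨h1, by rw [h2, h3]; ring⟩
    · rintro ⟨h1, h2⟩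
      have h3 := hMP y h1
      have h4 := hg y h1
      have h5 : g y = 0 := by linarith
      rw [h5] at h2
      exact ⟨⟨h1, h5⟩, by linarith⟩

theorem originFaces_halfspace_eq (h0 : (0 : Euc n) ∈ P) (hP : Convex ℝ P)
    (hpos : ∃ y ∈ P, 0 < l y) (hneg : ∃ y ∈ P, l y < 0) :
    originFaces (P ∩ {y | 0 ≤ l y}) =
      (fun F => F ∩ {y | 0 ≤ l y}) '' {F ∈ originFaces P | ∃ y ∈ F, 0 < l y} ∪
        originFaces (P ∩ {y | l y = 0}) := by
  ext G
  constructor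
  · intro hG
    rcases mem_originFaces_halfspace l h0 hP hpos hneg hG with h | ⟨F, hF, hFp, rfl⟩
    · exact Or.inr h
    · exact Or.inl ⟨F, ⟨hF, hFp⟩, rfl⟩
  · rintro (⟨F, ⟨hF, -⟩, rfl⟩ | h)
    · exact inter_mem_originFaces h0 (map_zero l).ge hF
    · exact originFaces_hyperplane_subset l h0 hP hpos hneg h

theorem injOn_inter_halfspace (h0 : (0 : Euc n) ∈ P) (hP : Convex ℝ P) :
    Set.InjOn (fun F => F ∩ {y | 0 ≤ l y}) {F ∈ originFaces P | ∃ y ∈ F, 0 < l y} := by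
  have key : ∀ F G : Set (Euc n), F ∈ originFaces P → G ∈ originFaces P →
      (∃ y ∈ F, 0 < l y) → F ∩ {y | 0 ≤ l y} = G ∩ {y | 0 ≤ l y} → F ⊆ G := by
    intro F G hF hG hFp h
    by_cases hFn : ∃ y ∈ F, l y < 0
    · refine subset_of_inter_hyperplane_subset l h0 hP hF hG hFp hFn ?_
      rintro y ⟨hy, hl⟩
      have : y ∈ F ∩ {y | 0 ≤ l y} := ⟨hy, Eq.ge hl⟩
      exact (h ▸ this).1
    · push Not at hFn
      intro y hy
      have : y ∈ F ∩ {y | 0 ≤ l y} := ⟨hy, hFn y hy⟩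
      exact (h ▸ this).1
  rintro F ⟨hF, hFp⟩ G ⟨hG, hGp⟩ h
  exact (key F G hF hG hFp h).antisymm (key G F hG hF hGp h.symm)

theorem originFaces_hyperplane_eq (hP : IsPolytope0 P)
    (hpos : ∃ y ∈ P, 0 < l y) (hneg : ∃ y ∈ P, l y < 0) :
    originFaces (P ∩ {y | l y = 0}) =
      {F ∈ originFaces P | ∀ y ∈ F, l y = 0} ∪
      (fun F => F ∩ {y | l y = 0}) ''
        {F ∈ originFaces P | (∃ y ∈ F, 0 < l y) ∧ ∃ y ∈ F, l y < 0} := by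
  have h0 := hP.zero_mem
  ext G
  constructor
  · intro hG
    obtain ⟨F, hF, rfl⟩ := exists_originFaces_of_hyperplane l h0 hP.convex hpos hneg hG
    by_cases hFp : ∃ y ∈ F, 0 < l y
    · by_cases hFn : ∃ y ∈ F, l y < 0
      · exact Or.inr ⟨F, ⟨hF, hFp, hFn⟩, rfl⟩
      · push Not at hFn
        exact Or.inl ⟨inter_hyperplane_mem_originFaces l hP hF hFn, fun y hy => hy.2⟩
    · push Not at hFp
      have := inter_hyperplane_mem_originFaces (-l) hP hF
        (fun y hy => by simpa using hFp y hy)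
      simp only [LinearMap.neg_apply, neg_eq_zero] at this
      exact Or.inl ⟨this, fun y hy => hy.2⟩
  · rintro (⟨hG, hl⟩ | ⟨F, ⟨hF, -⟩, rfl⟩)
    · have := inter_mem_originFaces (C := {y | l y = 0}) h0 (map_zero l) hG
      rwa [Set.inter_eq_left.2 (show G ⊆ {y | l y = 0} from hl)] at this
    · exact inter_mem_originFaces h0 (map_zero l) hF

/-- The sum of a set function over the faces through the origin. -/
def originFaceSum {n : ℕ} (u : Set (Euc n) → ℝ) (P : Set (Euc n)) : ℝ :=
  ∑ᶠ F ∈ originFaces P, u F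

theorem originFaceSum_halfspace (u : Set (Euc n) → ℝ) (hP : IsPolytope0 P)
    (hpos : ∃ y ∈ P, 0 < l y) (hneg : ∃ y ∈ P, l y < 0) :
    originFaceSum u (P ∩ {y | 0 ≤ l y}) =
      ∑ᶠ F ∈ {F ∈ originFaces P | (∃ y ∈ F, 0 < l y) ∧ ∀ y ∈ F, 0 ≤ l y}, u F +
      ∑ᶠ F ∈ {F ∈ originFaces P | (∃ y ∈ F, 0 < l y) ∧ ∃ y ∈ F, l y < 0},
        u (F ∩ {y | 0 ≤ l y}) + originFaceSum u (P ∩ {y | l y = 0}) := by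
  have h0 := hP.zero_mem
  have hfin := originFaces_finite hP
  rw [originFaceSum, originFaces_halfspace_eq l h0 hP.convex hpos hneg, finsum_mem_union,
    finsum_mem_image (injOn_inter_halfspace l h0 hP.convex)]
  · rw [originFaceSum]
    congr 1
    have hsplit : {F ∈ originFaces P | ∃ y ∈ F, 0 < l y} =
        {F ∈ originFaces P | (∃ y ∈ F, 0 < l y) ∧ ∀ y ∈ F, 0 ≤ l y} ∪
        {F ∈ originFaces P | (∃ y ∈ F, 0 < l y) ∧ ∃ y ∈ F, l y < 0} := by
      ext F
      simp only [Set.mem_ofPred_eq, Set.mem_union]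
      by_cases h : ∃ y ∈ F, l y < 0
      · tauto
      · push Not at h
        exact ⟨fun ⟨a, b⟩ => Or.inl ⟨a, b, h⟩, by rintro (⟨a, b, -⟩ | ⟨a, b, -⟩) <;> exact ⟨a, b⟩⟩
    rw [hsplit, finsum_mem_union]
    · congr 1
      refine finsum_mem_congr rfl ?_
      rintro F ⟨-, -, hF⟩
      rw [Set.inter_eq_left.2 (show F ⊆ {y | 0 ≤ l y} from hF)]
    · rw [Set.disjoint_left]
      rintro F ⟨-, -, hF⟩ ⟨-, -, y, hy, hl⟩
      linarith [hF y hy]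
    · exact hfin.subset (Set.sep_subset _ _)
    · exact hfin.subset (Set.sep_subset _ _)
  · rw [Set.disjoint_left]
    rintro _ ⟨F, ⟨hF, y, hy, hl⟩, rfl⟩ hG
    have : y ∈ P ∩ {y | l y = 0} := hG.1.subset ⟨hy, le_of_lt hl⟩
    have h2 : l y = 0 := this.2
    linarith
  · exact (hfin.subset (Set.sep_subset _ _)).image _
  · rw [originFaces_hyperplane_eq l hP hpos hneg]
    exact (hfin.subset (Set.sep_subset _ _)).union ((hfin.subset (Set.sep_subset _ _)).image _)

theorem originFaceSum_hyperplane (u : Set (Euc n) → ℝ) (hP : IsPolytope0 P)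
    (hpos : ∃ y ∈ P, 0 < l y) (hneg : ∃ y ∈ P, l y < 0) :
    originFaceSum u (P ∩ {y | l y = 0}) =
      ∑ᶠ F ∈ {F ∈ originFaces P | ∀ y ∈ F, l y = 0}, u F +
      ∑ᶠ F ∈ {F ∈ originFaces P | (∃ y ∈ F, 0 < l y) ∧ ∃ y ∈ F, l y < 0},
        u (F ∩ {y | l y = 0}) := by
  have h0 := hP.zero_mem
  have hfin := originFaces_finite hP
  rw [originFaceSum, originFaces_hyperplane_eq l hP hpos hneg, finsum_mem_union,
    finsum_mem_image]
  · rintro F ⟨hF, hFp, hFn⟩ G ⟨hG, hGp, hGn⟩ h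
    simp only at h
    exact (subset_of_inter_hyperplane_subset l h0 hP.convex hF hG hFp hFn
        (h.le.trans Set.inter_subset_left)).antisymm
      (subset_of_inter_hyperplane_subset l h0 hP.convex hG hF hGp hGn
        (h.ge.trans Set.inter_subset_left))
  · rw [Set.disjoint_left]
    rintro _ ⟨hG, hl⟩ ⟨F, ⟨hF, ⟨y, hy, hly⟩, hFn⟩, rfl⟩
    have := subset_of_inter_hyperplane_subset l h0 hP.convex hF hG ⟨y, hy, hly⟩ hFn subset_rfl
    have h2 := hl y (this hy)
    linarith
  · exact hfin.subset (Set.sep_subset _ _)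
  · exact (hfin.subset (Set.sep_subset _ _)).image _

theorem originFaceSum_eq (u : Set (Euc n) → ℝ) (hP : IsPolytope0 P) :
    originFaceSum u P =
      ∑ᶠ F ∈ {F ∈ originFaces P | ∀ y ∈ F, l y = 0}, u F +
      ∑ᶠ F ∈ {F ∈ originFaces P | (∃ y ∈ F, 0 < l y) ∧ ∀ y ∈ F, 0 ≤ l y}, u F +
      ∑ᶠ F ∈ {F ∈ originFaces P | (∃ y ∈ F, l y < 0) ∧ ∀ y ∈ F, l y ≤ 0}, u F +
      ∑ᶠ F ∈ {F ∈ originFaces P | (∃ y ∈ F, 0 < l y) ∧ ∃ y ∈ F, l y < 0}, u F := by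
  have hfin := originFaces_finite hP
  rw [← finsum_mem_union, ← finsum_mem_union, ← finsum_mem_union, originFaceSum]
  · refine finsum_mem_congr ?_ fun _ _ => rfl
    ext F
    simp only [Set.mem_union, Set.mem_ofPred_eq]
    by_cases h1 : ∃ y ∈ F, 0 < l y
    · by_cases h2 : ∃ y ∈ F, l y < 0
      · tauto
      · push Not at h2
        exact ⟨fun a => Or.inl (Or.inl (Or.inr ⟨a, h1, h2⟩)),
          by rintro (((⟨a, -⟩ | ⟨a, -⟩) | ⟨a, -⟩) | ⟨a, -⟩) <;> exact a⟩
    · by_cases h2 : ∃ y ∈ F, l y < 0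
      · push Not at h1
        exact ⟨fun a => Or.inl (Or.inr ⟨a, h2, h1⟩),
          by rintro (((⟨a, -⟩ | ⟨a, -⟩) | ⟨a, -⟩) | ⟨a, -⟩) <;> exact a⟩
      · push Not at h1 h2
        have : ∀ y ∈ F, l y = 0 := fun y hy => le_antisymm (h1 y hy) (h2 y hy)
        tauto
  · rw [Set.disjoint_left]
    rintro F ((⟨-, h⟩ | ⟨-, -, h⟩) | ⟨-, -, h⟩) ⟨-, ⟨y, hy, hly⟩, ⟨z, hz, hlz⟩⟩
    · linarith [h y hy]
    · linarith [h z hz]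
    · linarith [h y hy]
  · exact ((hfin.subset (Set.sep_subset _ _)).union (hfin.subset (Set.sep_subset _ _))).union
      (hfin.subset (Set.sep_subset _ _))
  · exact hfin.subset (Set.sep_subset _ _)
  · rw [Set.disjoint_left]
    rintro F (⟨-, h⟩ | ⟨-, -, h⟩) ⟨-, ⟨y, hy, hly⟩, -⟩
    · linarith [h y hy]
    · linarith [h y hy]
  · exact (hfin.subset (Set.sep_subset _ _)).union (hfin.subset (Set.sep_subset _ _))
  · exact hfin.subset (Set.sep_subset _ _)
  · rw [Set.disjoint_left]
    rintro F ⟨-, h⟩ ⟨-, ⟨y, hy, hly⟩, -⟩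
    linarith [h y hy]
  · exact hfin.subset (Set.sep_subset _ _)
  · exact hfin.subset (Set.sep_subset _ _)

theorem originFaceSum_cut (u : Set (Euc n) → ℝ) (hP : IsPolytope0 P)
    (hu : ∀ F ∈ originFaces P, (∃ y ∈ F, 0 < l y) → (∃ y ∈ F, l y < 0) →
      u F = u (F ∩ {y | 0 ≤ l y}) + u (F ∩ {y | l y ≤ 0}) + u (F ∩ {y | l y = 0})) :
    originFaceSum u P + originFaceSum u (P ∩ {y | l y = 0}) =
      originFaceSum u (P ∩ {y | 0 ≤ l y}) + originFaceSum u (P ∩ {y | l y ≤ 0}) := by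
  by_cases hpos : ∃ y ∈ P, 0 < l y
  swap
  · push Not at hpos
    have h1 : P ∩ {y | l y ≤ 0} = P := Set.inter_eq_left.2 hpos
    have h2 : P ∩ {y | 0 ≤ l y} = P ∩ {y | l y = 0} := by
      ext y
      exact and_congr_right fun hy => ⟨fun h => le_antisymm (hpos y hy) h, fun h => Eq.ge h⟩
    rw [h1, h2, add_comm]
  by_cases hneg : ∃ y ∈ P, l y < 0
  swap
  · push Not at hneg
    have h1 : P ∩ {y | 0 ≤ l y} = P := Set.inter_eq_left.2 hneg
    have h2 : P ∩ {y | l y ≤ 0} = P ∩ {y | l y = 0} := by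
      ext y
      exact and_congr_right fun hy => ⟨fun h => le_antisymm h (hneg y hy), fun h => Eq.le h⟩
    rw [h1, h2]
  have hfin := originFaces_finite hP
  have e1 := originFaceSum_halfspace l u hP hpos hneg
  have e2 := originFaceSum_halfspace (-l) u hP (by simpa using hneg) (by simpa using hpos)
  simp only [LinearMap.neg_apply, Left.nonneg_neg_iff, Left.neg_pos_iff, Left.neg_neg_iff,
    neg_eq_zero] at e2
  have e3 := originFaceSum_hyperplane l u hP hpos hneg
  have e4 := originFaceSum_eq l u hP
  have hswap : {F ∈ originFaces P | (∃ y ∈ F, l y < 0) ∧ ∃ y ∈ F, 0 < l y} =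
      {F ∈ originFaces P | (∃ y ∈ F, 0 < l y) ∧ ∃ y ∈ F, l y < 0} := by
    ext F
    simp only [Set.mem_ofPred_eq]
    tauto
  rw [hswap] at e2
  have e5 : ∑ᶠ F ∈ {F ∈ originFaces P | (∃ y ∈ F, 0 < l y) ∧ ∃ y ∈ F, l y < 0}, u F =
      ∑ᶠ F ∈ {F ∈ originFaces P | (∃ y ∈ F, 0 < l y) ∧ ∃ y ∈ F, l y < 0},
        u (F ∩ {y | 0 ≤ l y}) +
      ∑ᶠ F ∈ {F ∈ originFaces P | (∃ y ∈ F, 0 < l y) ∧ ∃ y ∈ F, l y < 0},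
        u (F ∩ {y | l y ≤ 0}) +
      ∑ᶠ F ∈ {F ∈ originFaces P | (∃ y ∈ F, 0 < l y) ∧ ∃ y ∈ F, l y < 0},
        u (F ∩ {y | l y = 0}) := by
    rw [← finsum_mem_add_distrib (hfin.subset (Set.sep_subset _ _)),
      ← finsum_mem_add_distrib (hfin.subset (Set.sep_subset _ _))]
    exact finsum_mem_congr rfl fun F hF => hu F hF.1 hF.2.1 hF.2.2
  linarith

end Cut

section Support

variable {n : ℕ}

theorem IsCompact.bddAbove_inner {K : Set (Euc n)} (hK : IsCompact K) (x : Euc n) :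
    BddAbove ((fun y => ⟪x, y⟫) '' K) :=
  (hK.image (by fun_prop)).bddAbove

theorem inner_le_supp {K : Set (Euc n)} (hK : IsCompact K) (x : Euc n) {y : Euc n} (hy : y ∈ K) :
    ⟪x, y⟫ ≤ supp K x :=
  le_csSup (hK.bddAbove_inner x) ⟨y, hy, rfl⟩

theorem supp_le {K : Set (Euc n)} (hK : K.Nonempty) {x : Euc n} {c : ℝ}
    (h : ∀ y ∈ K, ⟪x, y⟫ ≤ c) : supp K x ≤ c := by
  refine csSup_le (hK.image _) ?_
  rintro _ ⟨y, hy, rfl⟩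
  exact h y hy

theorem supp_nonneg {K : Set (Euc n)} (hK : IsCompact K) (h0 : (0 : Euc n) ∈ K) (x : Euc n) :
    0 ≤ supp K x := by
  simpa using inner_le_supp hK x h0

theorem exists_lt_of_lt_supp {K : Set (Euc n)} (hK : K.Nonempty) {x : Euc n} {c : ℝ}
    (h : c < supp K x) : ∃ y ∈ K, c < ⟪x, y⟫ := by
  by_contra! hc
  exact absurd (supp_le hK hc) (not_le.2 h)

theorem isClosed_halfspace (l : Euc n →ₗ[ℝ] ℝ) : IsClosed {y | 0 ≤ l y} :=
  isClosed_le continuous_const l.continuous_of_finiteDimensional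

theorem isClosed_halfspace_neg (l : Euc n →ₗ[ℝ] ℝ) : IsClosed {y | l y ≤ 0} :=
  isClosed_le l.continuous_of_finiteDimensional continuous_const

theorem isClosed_hyperplane (l : Euc n →ₗ[ℝ] ℝ) : IsClosed {y | l y = 0} :=
  isClosed_eq l.continuous_of_finiteDimensional continuous_const

/-- Powers of support functions are additive under cutting by a hyperplane through the origin. -/
theorem supp_rpow_cut {F : Set (Euc n)} (hF : IsCompact F) (hconv : Convex ℝ F)
    (h0 : (0 : Euc n) ∈ F) (l : Euc n →ₗ[ℝ] ℝ) (x : Euc n) (p : ℝ) :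
    supp F x ^ p + supp (F ∩ {y | l y = 0}) x ^ p
      = supp (F ∩ {y | 0 ≤ l y}) x ^ p + supp (F ∩ {y | l y ≤ 0}) x ^ p := by
  have c1 := hF.inter_right (isClosed_halfspace l)
  have c2 := hF.inter_right (isClosed_halfspace_neg l)
  have c3 := hF.inter_right (isClosed_hyperplane l)
  have n1 : (0 : Euc n) ∈ F ∩ {y | 0 ≤ l y} := ⟨h0, (map_zero l).ge⟩
  have n2 : (0 : Euc n) ∈ F ∩ {y | l y ≤ 0} := ⟨h0, (map_zero l).le⟩
  have n3 : (0 : Euc n) ∈ F ∩ {y | l y = 0} := ⟨h0, map_zero l⟩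
  have hmax : supp F x = max (supp (F ∩ {y | 0 ≤ l y}) x) (supp (F ∩ {y | l y ≤ 0}) x) := by
    apply le_antisymm
    · refine supp_le ⟨0, h0⟩ fun y hy => ?_
      rcases le_total 0 (l y) with h | h
      · exact le_max_of_le_left (inner_le_supp c1 x ⟨hy, h⟩)
      · exact le_max_of_le_right (inner_le_supp c2 x ⟨hy, h⟩)
    · exact max_le (supp_le ⟨0, n1⟩ fun y hy => inner_le_supp hF x hy.1)
        (supp_le ⟨0, n2⟩ fun y hy => inner_le_supp hF x hy.1)
  have hmin : supp (F ∩ {y | l y = 0}) x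
      = min (supp (F ∩ {y | 0 ≤ l y}) x) (supp (F ∩ {y | l y ≤ 0}) x) := by
    apply le_antisymm
    · exact le_min (supp_le ⟨0, n3⟩ fun y hy => inner_le_supp c1 x ⟨hy.1, hy.2.ge⟩)
        (supp_le ⟨0, n3⟩ fun y hy => inner_le_supp c2 x ⟨hy.1, hy.2.le⟩)
    · by_contra! h
      obtain ⟨h1, h2⟩ := lt_min_iff.1 h
      obtain ⟨y, hy, hy'⟩ := exists_lt_of_lt_supp ⟨0, n1⟩ h1
      obtain ⟨z, hz, hz'⟩ := exists_lt_of_lt_supp ⟨0, n2⟩ h2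
      have hly : 0 < l y := lt_of_le_of_ne hy.2 fun h =>
        absurd (inner_le_supp c3 x ⟨hy.1, h.symm⟩) (not_le.2 hy')
      have hlz : l z < 0 := lt_of_le_of_ne hz.2 fun h =>
        absurd (inner_le_supp c3 x ⟨hz.1, h⟩) (not_le.2 hz')
      obtain ⟨a, b, ha, hb, hab, hm, hl0⟩ := exists_mem_hyperplane hconv l hy.1 hz.1 hly hlz
      have h3 := inner_le_supp c3 x ⟨hm, hl0⟩
      rw [inner_add_right, inner_smul_right, inner_smul_right] at h3
      have e : supp (F ∩ {y | l y = 0}) x = a * supp (F ∩ {y | l y = 0}) x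
        + b * supp (F ∩ {y | l y = 0}) x := by rw [← add_mul, hab, one_mul]
      have := mul_lt_mul_of_pos_left hy' ha
      have := mul_lt_mul_of_pos_left hz' hb
      linarith
  rw [hmax, hmin]
  rcases le_total (supp (F ∩ {y | 0 ≤ l y}) x) (supp (F ∩ {y | l y ≤ 0}) x) with h | h
  · rw [max_eq_right h, min_eq_left h, add_comm]
  · rw [max_eq_left h, min_eq_right h]

end Support

section Dimension

variable {E : Type*} [AddCommGroup E] [Module ℝ E] {F : Set E}

theorem span_inter_halfspace (hF : Convex ℝ F) (l : E →ₗ[ℝ] ℝ) (hpos : ∃ y ∈ F, 0 < l y) :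
    Submodule.span ℝ (F ∩ {y | 0 ≤ l y}) = Submodule.span ℝ F := by
  refine le_antisymm (Submodule.span_mono Set.inter_subset_left) (Submodule.span_le.2 ?_)
  intro z hz
  obtain ⟨y, hy, hly⟩ := hpos
  rcases le_or_gt 0 (l z) with h | h
  · exact Submodule.subset_span ⟨hz, h⟩
  · obtain ⟨a, b, ha, hb, hab, hm, hl0⟩ := exists_mem_hyperplane hF l hy hz hly h
    have h1 : a • y + b • z ∈ Submodule.span ℝ (F ∩ {y | 0 ≤ l y}) :=
      Submodule.subset_span ⟨hm, hl0.ge⟩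
    have h2 : a • y ∈ Submodule.span ℝ (F ∩ {y | 0 ≤ l y}) :=
      Submodule.smul_mem _ _ (Submodule.subset_span ⟨hy, hly.le⟩)
    exact (Submodule.smul_mem_iff _ hb.ne').1 ((Submodule.add_mem_iff_right _ h2).1 h1)

theorem span_inter_halfspace_neg (hF : Convex ℝ F) (l : E →ₗ[ℝ] ℝ) (hneg : ∃ y ∈ F, l y < 0) :
    Submodule.span ℝ (F ∩ {y | l y ≤ 0}) = Submodule.span ℝ F := by
  have := span_inter_halfspace hF (-l) (by simpa using hneg)
  simpa using this

theorem finrank_span_inter_hyperplane [FiniteDimensional ℝ E] (hF : Convex ℝ F) (l : E →ₗ[ℝ] ℝ)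
    (hpos : ∃ y ∈ F, 0 < l y) (hneg : ∃ y ∈ F, l y < 0) :
    Module.finrank ℝ (Submodule.span ℝ (F ∩ {y | l y = 0})) + 1
      = Module.finrank ℝ (Submodule.span ℝ F) := by
  obtain ⟨y, hy, hly⟩ := hpos
  obtain ⟨z, hz, hlz⟩ := hneg
  set S := Submodule.span ℝ (F ∩ {y | l y = 0}) with hS
  have hSl : ∀ w ∈ S, l w = 0 := by
    have : S ≤ LinearMap.ker l := Submodule.span_le.2 fun w hw => hw.2
    exact fun w hw => this hw
  have hyT : y ∈ S ⊔ Submodule.span ℝ {y} :=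
    le_sup_right (a := S) (Submodule.mem_span_singleton_self y)
  have hneg' : ∀ w ∈ F, l w < 0 → w ∈ S ⊔ Submodule.span ℝ {y} := by
    intro w hw hlw
    obtain ⟨a, b, ha, hb, hab, hm, hl0⟩ := exists_mem_hyperplane hF l hy hw hly hlw
    have h1 : a • y + b • w ∈ S ⊔ Submodule.span ℝ {y} :=
      le_sup_left (a := S) (Submodule.subset_span ⟨hm, hl0⟩)
    exact (Submodule.smul_mem_iff _ hb.ne').1
      ((Submodule.add_mem_iff_right _ (Submodule.smul_mem _ a hyT)).1 h1)
  have hT : Submodule.span ℝ F = S ⊔ Submodule.span ℝ {y} := by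
    apply le_antisymm
    · refine Submodule.span_le.2 fun w hw => ?_
      rcases lt_trichotomy (l w) 0 with h | h | h
      · exact hneg' w hw h
      · exact le_sup_left (a := S) (Submodule.subset_span ⟨hw, h⟩)
      · obtain ⟨a, b, ha, hb, hab, hm, hl0⟩ := exists_mem_hyperplane hF l hw hz h hlz
        have h1 : a • w + b • z ∈ S ⊔ Submodule.span ℝ {y} :=
          le_sup_left (a := S) (Submodule.subset_span ⟨hm, hl0⟩)
        exact (Submodule.smul_mem_iff _ ha.ne').1
          ((Submodule.add_mem_iff_left _ (Submodule.smul_mem _ b (hneg' z hz hlz))).1 h1)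
    · exact sup_le (Submodule.span_mono Set.inter_subset_left)
        (Submodule.span_mono (Set.singleton_subset_iff.2 hy))
  have hd : S ⊓ Submodule.span ℝ {y} = ⊥ := by
    refine (Submodule.eq_bot_iff _).2 ?_
    rintro w ⟨hw1, hw2⟩
    obtain ⟨c, rfl⟩ := Submodule.mem_span_singleton.1 hw2
    have := hSl _ hw1
    rw [map_smul, smul_eq_mul] at this
    rcases mul_eq_zero.1 this with h | h
    · rw [h, zero_smul]
    · exact absurd h hly.ne'
  have hy0 : y ≠ 0 := fun h => by simp [h] at hly
  have := Submodule.finrank_sup_add_finrank_inf_eq S (Submodule.span ℝ {y})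
  rw [hd, finrank_bot, finrank_span_singleton hy0, add_zero] at this
  rw [hT, this]

end Dimension

/-- The power of the support function at `x` with the sign given by the parity of the dimension. -/
def signedSupp {n : ℕ} (p : ℝ) (x : Euc n) (F : Set (Euc n)) : ℝ :=
  (-1) ^ sdim F * supp F x ^ p

theorem signedSupp_cut {n : ℕ} {F : Set (Euc n)} (hF : IsCompact F) (hconv : Convex ℝ F)
    (h0 : (0 : Euc n) ∈ F) (l : Euc n →ₗ[ℝ] ℝ) (p : ℝ) (x : Euc n)
    (hpos : ∃ y ∈ F, 0 < l y) (hneg : ∃ y ∈ F, l y < 0) :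
    signedSupp p x F = signedSupp p x (F ∩ {y | 0 ≤ l y}) + signedSupp p x (F ∩ {y | l y ≤ 0})
      + signedSupp p x (F ∩ {y | l y = 0}) := by
  have n1 : (0 : Euc n) ∈ F ∩ {y | 0 ≤ l y} := ⟨h0, (map_zero l).ge⟩
  have n2 : (0 : Euc n) ∈ F ∩ {y | l y ≤ 0} := ⟨h0, (map_zero l).le⟩
  have n3 : (0 : Euc n) ∈ F ∩ {y | l y = 0} := ⟨h0, map_zero l⟩
  have h := supp_rpow_cut hF hconv h0 l x p
  simp only [signedSupp]
  rw [sdim_eq_finrank_span h0, sdim_eq_finrank_span n1, sdim_eq_finrank_span n2,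
    sdim_eq_finrank_span n3, span_inter_halfspace hconv l hpos,
    span_inter_halfspace_neg hconv l hneg, ← finrank_span_inter_hyperplane hconv l hpos hneg,
    pow_succ]
  linear_combination (-1 : ℝ) ^ (Module.finrank ℝ (Submodule.span ℝ (F ∩ {y | l y = 0}))) * (-1) * h

theorem originFaceSum_signedSupp_cut {n : ℕ} {P : Set (Euc n)} (hP : IsPolytope0 P)
    (l : Euc n →ₗ[ℝ] ℝ) (p : ℝ) (x : Euc n) :
    originFaceSum (signedSupp p x) P + originFaceSum (signedSupp p x) (P ∩ {y | l y = 0})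
      = originFaceSum (signedSupp p x) (P ∩ {y | 0 ≤ l y})
        + originFaceSum (signedSupp p x) (P ∩ {y | l y ≤ 0}) := by
  refine originFaceSum_cut l _ hP fun F hF hpos hneg => ?_
  exact signedSupp_cut (hF.1.isCompact hP.isCompact) (hF.1.convex hP.convex) hF.2 l p x hpos hneg

section PhiP

variable {n : ℕ}

theorem sdim_le_of_subset {P F : Set (Euc n)} (hF : F ⊆ P) (h0 : (0 : Euc n) ∈ F) :
    sdim F ≤ sdim P := by
  rw [sdim_eq_finrank_span h0, sdim_eq_finrank_span (hF h0)]
  exact Submodule.finrank_mono (Submodule.span_mono hF)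

theorem eq_of_mem_originFaces_of_sdim_eq {P F : Set (Euc n)} (h0 : (0 : Euc n) ∈ P)
    (hF : F ∈ originFaces P) (hd : sdim F = sdim P) : F = P := by
  have hF0 := hF.2
  obtain ⟨g, hg, rfl⟩ := (mem_originFaces h0).1 hF
  rw [sdim_eq_finrank_span hF0, sdim_eq_finrank_span h0] at hd
  have hsub : {y ∈ P | g y = 0} ⊆ P := fun y hy => hy.1
  have hs := Submodule.eq_of_le_of_finrank_eq (Submodule.span_mono hsub) hd
  have hker : Submodule.span ℝ {y ∈ P | g y = 0} ≤ LinearMap.ker g :=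
    Submodule.span_le.2 fun y hy => hy.2
  rw [hs] at hker
  exact Set.Subset.antisymm hsub fun y hy => ⟨hy, hker (Submodule.subset_span hy)⟩

theorem supp_rpow_eq_zero {F : Set (Euc n)} (h0 : (0 : Euc n) ∈ F) (hd : sdim F = 0) (x : Euc n)
    {p : ℝ} (hp : p ≠ 0) : supp F x ^ p = 0 := by
  rw [sdim_eq_finrank_span h0, Submodule.finrank_eq_zero, Submodule.span_eq_bot] at hd
  have hF : F = {0} := Set.eq_singleton_iff_unique_mem.2 ⟨h0, hd⟩
  rw [hF, supp, Set.image_singleton, csSup_singleton, inner_zero_right, Real.zero_rpow hp]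

theorem PhiP_eq {p : ℝ} (hp : p ≠ 0) (a₁ a₂ : ℝ) {P : Set (Euc n)} (hP : IsPolytope0 P)
    (x : Euc n) :
    PhiP p a₁ a₂ P x = a₂ * supp P x ^ p + (a₂ - a₁) * originFaceSum (signedSupp p x) P := by
  have hfin := originFaces_finite hP
  have hsum : originFaceSum (signedSupp p x) P = ∑ j ∈ Finset.range (sdim P + 1),
      (-1 : ℝ) ^ j * ∑ᶠ F ∈ facesO j P, supp F x ^ p := by
    rw [originFaceSum, finsum_mem_eq_finite_toFinset_sum _ hfin,
      ← Finset.sum_fiberwise_of_maps_to (g := sdim) (t := Finset.range (sdim P + 1))]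
    · refine Finset.sum_congr rfl fun j _ => ?_
      have hset : facesO j P = ((hfin.toFinset.filter fun F => sdim F = j : Finset _) :
          Set (Set (Euc n))) := by
        ext F
        simp only [facesO, originFaces, Finset.coe_filter, Set.Finite.mem_toFinset,
          Set.mem_ofPred_eq]
        tauto
      rw [hset, finsum_mem_coe_finset, Finset.mul_sum]
      refine Finset.sum_congr rfl fun F hF => ?_
      rw [signedSupp, (Finset.mem_filter.1 hF).2]
    · intro F hF
      have hF' := hfin.mem_toFinset.1 hF
      exact Finset.mem_range_succ_iff.2 (sdim_le_of_subset hF'.1.subset hF'.2)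
  have hzero : ∑ᶠ F ∈ facesO 0 P, supp F x ^ p = 0 := by
    refine (finsum_mem_congr rfl fun F hF => ?_).trans (finsum_mem_zero _)
    exact supp_rpow_eq_zero hF.2.2 hF.2.1 x hp
  have htop : ∑ᶠ F ∈ facesO (sdim P) P, supp F x ^ p = supp P x ^ p := by
    have : facesO (sdim P) P = {P} := by
      refine Set.eq_singleton_iff_unique_mem.2 ⟨⟨IsExposed.refl P, rfl, hP.zero_mem⟩, ?_⟩
      exact fun F hF => eq_of_mem_originFaces_of_sdim_eq hP.zero_mem ⟨hF.1, hF.2.2⟩ hF.2.1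
    rw [this, finsum_mem_singleton]
  rcases Nat.eq_zero_or_pos (sdim P) with hd | hd
  · rw [hsum, PhiP, supp_rpow_eq_zero hP.zero_mem hd x hp]
    simp [hd, hzero]
  · have hrange : Finset.range (sdim P + 1)
        = insert 0 (insert (sdim P) (Finset.Icc 1 (sdim P - 1))) := by
      ext j
      simp only [Finset.mem_range, Finset.mem_insert, Finset.mem_Icc]
      omega
    rw [hsum, hrange, Finset.sum_insert, Finset.sum_insert, hzero, htop, PhiP]
    · rcases Nat.even_or_odd (sdim P) with h | h
      · rw [if_neg (Nat.not_odd_iff_even.2 h), h.neg_one_pow]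
        ring
      · rw [if_pos h, h.neg_one_pow]
        ring
    · simp only [Finset.mem_Icc]
      omega
    · simp only [Finset.mem_insert, Finset.mem_Icc]
      omega

theorem PhiP_cut {p : ℝ} (hp : p ≠ 0) (a₁ a₂ : ℝ) {P : Set (Euc n)} (hP : IsPolytope0 P)
    (l : Euc n →ₗ[ℝ] ℝ) (h₁ : IsPolytope0 (P ∩ {y | 0 ≤ l y}))
    (h₂ : IsPolytope0 (P ∩ {y | l y ≤ 0})) (h₃ : IsPolytope0 (P ∩ {y | l y = 0})) (x : Euc n) :
    PhiP p a₁ a₂ P x + PhiP p a₁ a₂ (P ∩ {y | l y = 0}) x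
      = PhiP p a₁ a₂ (P ∩ {y | 0 ≤ l y}) x + PhiP p a₁ a₂ (P ∩ {y | l y ≤ 0}) x := by
  rw [PhiP_eq hp _ _ hP, PhiP_eq hp _ _ h₁, PhiP_eq hp _ _ h₂, PhiP_eq hp _ _ h₃]
  linear_combination a₂ * supp_rpow_cut hP.isCompact hP.convex hP.zero_mem l x p
    + (a₂ - a₁) * originFaceSum_signedSupp_cut hP l p x

end PhiP

section Extension

variable {K V ι : Type*} [Field K] [AddCommGroup V] [Module K V] [FiniteDimensional K V]
  [Fintype ι]

/-- A linear map of determinant one taking one linearly independent family, not a basis, to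
another. -/
theorem exists_det_eq_one_map_eq {v w : ι → V} (hv : LinearIndependent K v)
    (hw : LinearIndependent K w) (hι : Fintype.card ι < Module.finrank K V) :
    ∃ f : V →ₗ[K] V, LinearMap.det f = 1 ∧ ∀ i, f (v i) = w i := by
  obtain ⟨e, he⟩ := Submodule.exists_linearEquiv_restrict_eq
    (hv.linearCombinationEquiv.symm.trans hw.linearCombinationEquiv)
  have hev : ∀ i, e (v i) = w i := by
    intro i
    have h1 := he (hv.linearCombinationEquiv (Finsupp.single i 1))
    rw [LinearEquiv.trans_apply, LinearEquiv.symm_apply_apply] at h1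
    simpa using h1.symm
  have hlt : Submodule.span K (Set.range w) < ⊤ := by
    refine lt_top_iff_ne_top.2 fun h => ?_
    have := finrank_span_eq_card hw
    rw [h, finrank_top] at this
    omega
  obtain ⟨g, hg0, hg⟩ := Submodule.exists_le_ker_of_lt_top _ hlt
  obtain ⟨u, hu⟩ := DFunLike.ne_iff.1 hg0
  rw [LinearMap.zero_apply] at hu
  have hd : LinearMap.det (e : V →ₗ[K] V) ≠ 0 := e.isUnit_det'.ne_zero
  refine ⟨LinearMap.transvection g
    ((((LinearMap.det (e : V →ₗ[K] V))⁻¹ - 1) / g u) • u) ∘ₗ (e : V →ₗ[K] V), ?_, fun i => ?_⟩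
  · rw [LinearMap.det_comp, LinearMap.transvection.det, map_smul, smul_eq_mul, div_mul_cancel₀ _ hu]
    field_simp
    ring
  · have h0 : g (w i) = 0 := hg (Submodule.subset_span ⟨i, rfl⟩)
    simp [LinearMap.transvection.apply, hev, h0]

end Extension

section Covariance

variable {n : ℕ}

theorem IsPolytope0.image {P : Set (Euc n)} (hP : IsPolytope0 P) (f : Euc n →ₗ[ℝ] Euc n) :
    IsPolytope0 (f '' P) := by
  classical
  obtain ⟨⟨S, rfl⟩, h0⟩ := hP
  exact ⟨⟨S.image f, by rw [Finset.coe_image, f.image_convexHull]⟩, 0, h0, map_zero f⟩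

/-- A functional of polytopes and vectors that is `SL(n)` covariant and depends on the vector only
through its inner products with the points of the polytope. -/
def IsStronglyCovariant (D : Set (Euc n) → Euc n → ℝ) : Prop :=
  ∀ f : Euc n →ₗ[ℝ] Euc n, LinearMap.det f = 1 → ∀ P, IsPolytope0 P → ∀ x x' : Euc n,
    (∀ y ∈ P, ⟪x, f y⟫ = ⟪x', y⟫) → D (f '' P) x = D P x'

theorem isStronglyCovariant_of_specialLinearGroup (hn : 2 ≤ n) (Φ : Set (Euc n) → Euc n → ℝ)
    (hcont : ∀ P, IsPolytope0 P → Continuous (Φ P))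
    (hcov : ∀ (φ : Matrix.SpecialLinearGroup (Fin n) ℝ) (P : Set (Euc n)), IsPolytope0 P →
      ∀ x : Euc n, Φ (matAct (φ : Matrix (Fin n) (Fin n) ℝ) P) x
        = Φ P (matVec ((φ : Matrix (Fin n) (Fin n) ℝ))ᵀ x)) :
    IsStronglyCovariant Φ := by
  have hlin : ∀ f : Euc n →ₗ[ℝ] Euc n, LinearMap.det f = 1 → ∀ P, IsPolytope0 P → ∀ x,
      Φ (f '' P) x = Φ P (LinearMap.adjoint f x) := by
    intro f hf P hP x
    obtain ⟨A, rfl⟩ := (Matrix.toEuclideanLin (𝕜 := ℝ) (m := Fin n) (n := Fin n)).surjective f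
    have hA : A.det = 1 := by
      rw [← hf, Matrix.toEuclideanLin_eq_toLin_orthonormal, LinearMap.det_toLin]
    have := hcov ⟨A, hA⟩ P hP x
    rw [matAct, matVec, ← Matrix.conjTranspose_eq_transpose_of_trivial,
      Matrix.toEuclideanLin_conjTranspose_eq_adjoint] at this
    exact this
  have hind : ∀ P, IsPolytope0 P → ∀ x z : Euc n, (∀ y ∈ P, ⟪z, y⟫ = 0) →
      x ∉ Submodule.span ℝ {z} → Φ P x = Φ P (x + z) := by
    intro P hP x z hz hx
    rcases eq_or_ne z 0 with rfl | hz0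
    · rw [add_zero]
    set u : Euc n := x - (⟪z, x⟫ / ⟪z, z⟫) • z with hu
    have hzz : ⟪z, z⟫ ≠ 0 := inner_self_ne_zero.2 hz0
    have huz : ⟪z, u⟫ = 0 := by
      rw [hu, inner_sub_right, inner_smul_right, div_mul_cancel₀ _ hzz, sub_self]
    have hu0 : u ≠ 0 := by
      intro h
      exact hx (Submodule.mem_span_singleton.2 ⟨_, (sub_eq_zero.1 h).symm⟩)
    have huu : ⟪u, u⟫ ≠ 0 := inner_self_ne_zero.2 hu0
    have hux : ⟪u, x⟫ = ⟪u, u⟫ := by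
      have hx' : x = u + (⟪z, x⟫ / ⟪z, z⟫) • z := by rw [hu]; abel
      rw [hx', inner_add_right, inner_smul_right, real_inner_comm z u, huz, mul_zero, add_zero]
    set f : Euc n →ₗ[ℝ] Euc n := LinearMap.transvection
      (innerSL ℝ z : Euc n →L[ℝ] ℝ).toLinearMap ((⟪u, u⟫)⁻¹ • u) with hf
    have hfy : ∀ y, f y = y + ⟪z, y⟫ • ((⟪u, u⟫)⁻¹ • u) := fun y => rfl
    have hdet : LinearMap.det f = 1 := by
      rw [hf, LinearMap.transvection.det]
      simp [huz]
    have himg : f '' P = P := by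
      have : Set.EqOn f id P := fun y hy => by simp [hfy, hz y hy]
      rw [this.image_eq, Set.image_id]
    have hadj : LinearMap.adjoint f x = x + z := by
      refine ext_inner_right ℝ fun y => ?_
      rw [LinearMap.adjoint_inner_left, hfy, inner_add_right, inner_smul_right, inner_smul_right,
        real_inner_comm u x, hux, inner_add_left, inv_mul_cancel₀ huu, mul_one]
    have := hlin f hdet P hP x
    rwa [himg, hadj] at this
  have hdep : ∀ P, IsPolytope0 P → ∀ x z : Euc n, (∀ y ∈ P, ⟪z, y⟫ = 0) →
      Φ P x = Φ P (x + z) := by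
    intro P hP x z hz
    by_cases hx : x ∈ Submodule.span ℝ {z}
    · have hlt : Submodule.span ℝ {z} < ⊤ := by
        refine lt_top_iff_ne_top.2 fun h => ?_
        have := finrank_span_le_card (R := ℝ) ({z} : Set (Euc n))
        rw [h, finrank_top, finrank_euclideanSpace_fin] at this
        simp at this
        omega
      obtain ⟨q, -, hq⟩ := SetLike.exists_of_lt hlt
      have hΦ := hcont P hP
      have heq : (fun ε : ℝ => Φ P (x + ε • q)) = fun ε : ℝ => Φ P (x + ε • q + z) := by
        refine Continuous.ext_on (dense_compl_singleton (0 : ℝ)) (by fun_prop) (by fun_prop) ?_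
        intro ε hε
        refine hind P hP _ z hz fun hmem => hq ?_
        exact (Submodule.smul_mem_iff _ hε).1 ((Submodule.add_mem_iff_right _ hx).1 hmem)
      simpa using congrFun heq 0
    · exact hind P hP x z hz hx
  intro f hf P hP x x' hx
  rw [hlin f hf P hP x, hdep P hP x' (LinearMap.adjoint f x - x'), add_sub_cancel]
  intro y hy
  rw [inner_sub_left, LinearMap.adjoint_inner_left, hx y hy, sub_self]

theorem mem_originFaces_image (e : Euc n ≃ₗ[ℝ] Euc n) {P F : Set (Euc n)} (h0 : (0 : Euc n) ∈ P)
    (hF : F ∈ originFaces P) : e '' F ∈ originFaces (e '' P) := by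
  obtain ⟨g, hg, rfl⟩ := (mem_originFaces h0).1 hF
  refine (mem_originFaces (P := e '' P) ⟨0, h0, map_zero e⟩).2 ⟨g ∘ₗ e.symm, ?_, ?_⟩
  · rintro _ ⟨y, hy, rfl⟩
    simpa using hg y hy
  · ext y
    constructor
    · rintro ⟨y, hy, rfl⟩
      exact ⟨⟨y, hy.1, rfl⟩, by simpa using hy.2⟩
    · rintro ⟨⟨y, hy, rfl⟩, hgy⟩
      exact ⟨y, ⟨hy, by simpa using hgy⟩, rfl⟩

theorem originFaces_image (e : Euc n ≃ₗ[ℝ] Euc n) {P : Set (Euc n)} (h0 : (0 : Euc n) ∈ P) :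
    originFaces (e '' P) = (fun F => e '' F) '' originFaces P := by
  apply Set.Subset.antisymm
  · intro G hG
    have := mem_originFaces_image e.symm (P := e '' P) ⟨0, h0, map_zero e⟩ hG
    rw [Set.image_image, Set.image_congr fun y _ => e.symm_apply_apply y, Set.image_id'] at this
    refine ⟨_, this, ?_⟩
    simp only [Set.image_image, LinearEquiv.apply_symm_apply, Set.image_id']
  · rintro _ ⟨F, hF, rfl⟩
    exact mem_originFaces_image e h0 hF

theorem sdim_image (e : Euc n ≃ₗ[ℝ] Euc n) {P : Set (Euc n)} (h0 : (0 : Euc n) ∈ P) :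
    sdim (e '' P) = sdim P := by
  rw [sdim_eq_finrank_span h0, sdim_eq_finrank_span (P := e '' P) ⟨0, h0, map_zero e⟩]
  have : Submodule.span ℝ (e '' P) = (Submodule.span ℝ P).map (e : Euc n →ₗ[ℝ] Euc n) :=
    Submodule.span_image (e : Euc n →ₗ[ℝ] Euc n)
  rw [this]
  exact LinearEquiv.finrank_map_eq e _

theorem supp_image (f : Euc n → Euc n) {P : Set (Euc n)} {x x' : Euc n}
    (hx : ∀ y ∈ P, ⟪x, f y⟫ = ⟪x', y⟫) : supp (f '' P) x = supp P x' := by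
  rw [supp, supp, Set.image_image, Set.image_congr hx]

theorem PhiP_image {p : ℝ} (hp : p ≠ 0) (a₁ a₂ : ℝ) (e : Euc n ≃ₗ[ℝ] Euc n) {P : Set (Euc n)}
    (hP : IsPolytope0 P) {x x' : Euc n} (hx : ∀ y ∈ P, ⟪x, e y⟫ = ⟪x', y⟫) :
    PhiP p a₁ a₂ (e '' P) x = PhiP p a₁ a₂ P x' := by
  have hP' : IsPolytope0 (e '' P) := hP.image (e : Euc n →ₗ[ℝ] Euc n)
  rw [PhiP_eq hp _ _ hP, PhiP_eq hp _ _ hP', supp_image e hx,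
    originFaceSum, originFaceSum, originFaces_image e hP.zero_mem,
    finsum_mem_image (e.injective.image_injective.injOn)]
  refine congrArg₂ _ rfl (congrArg₂ _ rfl (finsum_mem_congr rfl fun F hF => ?_))
  rw [signedSupp, signedSupp, sdim_image e hF.2, supp_image e fun y hy => hx y (hF.1.subset hy)]

theorem isStronglyCovariant_PhiP {p : ℝ} (hp : p ≠ 0) (a₁ a₂ : ℝ) :
    IsStronglyCovariant (n := n) (PhiP p a₁ a₂) := by
  intro f hf P hP x x' hx
  have hu : IsUnit (LinearMap.det f) := by rw [hf]; exact isUnit_one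
  exact PhiP_image hp a₁ a₂ (LinearEquiv.ofIsUnitDet (v := Module.finBasis ℝ (Euc n))
    (v' := Module.finBasis ℝ (Euc n)) (f := f) (by rwa [LinearMap.det_toMatrix])) hP hx

theorem PhiP_neg_set {p : ℝ} (hp : p ≠ 0) (a₁ a₂ : ℝ) {P : Set (Euc n)} (hP : IsPolytope0 P)
    (x : Euc n) : PhiP p a₁ a₂ (-P) x = PhiP p a₁ a₂ P (-x) := by
  rw [← Set.image_neg_eq_neg]
  exact PhiP_image hp a₁ a₂ (LinearEquiv.neg ℝ) hP fun y _ => by simp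

theorem supp_smul {P : Set (Euc n)} (c : ℝ) (hc : 0 ≤ c) (x : Euc n) :
    supp P (c • x) = c * supp P x := by
  rw [supp, supp, ← smul_eq_mul, ← Real.sSup_smul_of_nonneg hc, ← Set.image_smul, Set.image_image]
  simp only [inner_smul_left, smul_eq_mul, RCLike.conj_to_real]

theorem PhiP_smul {p : ℝ} (a₁ a₂ : ℝ) {P : Set (Euc n)} (hP : IsPolytope0 P)
    {c : ℝ} (hc : 0 ≤ c) (x : Euc n) : PhiP p a₁ a₂ P (c • x) = c ^ p * PhiP p a₁ a₂ P x := by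
  have h : ∀ F : Set (Euc n), IsCompact F → (0 : Euc n) ∈ F →
      supp F (c • x) ^ p = c ^ p * supp F x ^ p := fun F hF h0 => by
    rw [supp_smul c hc, Real.mul_rpow hc (supp_nonneg hF h0 x)]
  rw [PhiP, PhiP, h P hP.isCompact hP.zero_mem, mul_add, Finset.mul_sum, Finset.mul_sum,
    Finset.mul_sum]
  congr 1
  · ring
  · refine Finset.sum_congr rfl fun j _ => ?_
    rw [finsum_mem_congr rfl fun F hF => h F (hF.1.isCompact hP.isCompact) hF.2.2,
      ← mul_finsum_mem]
    ring

end Covariance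

section OriginSimplex

variable {E ι κ : Type*} [AddCommGroup E] [Module ℝ E]

/-- The convex hull of the origin and a family of points. -/
def originSimplex (v : ι → E) : Set E := convexHull ℝ (insert 0 (Set.range v))

theorem zero_mem_originSimplex (v : ι → E) : (0 : E) ∈ originSimplex v :=
  subset_convexHull ℝ _ (Set.mem_insert _ _)

theorem mem_originSimplex_self (v : ι → E) (i : ι) : v i ∈ originSimplex v :=
  subset_convexHull ℝ _ (Set.mem_insert_of_mem _ ⟨i, rfl⟩)

theorem convex_originSimplex (v : ι → E) : Convex ℝ (originSimplex v) := convex_convexHull ℝ _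

theorem originSimplex_subset {v : ι → E} {C : Set E} (hC : Convex ℝ C) (h0 : (0 : E) ∈ C)
    (hv : ∀ i, v i ∈ C) : originSimplex v ⊆ C :=
  convexHull_min (Set.insert_subset h0 (Set.range_subset_iff.2 hv)) hC

theorem mem_originSimplex [Fintype ι] {v : ι → E} {y : E} :
    y ∈ originSimplex v ↔ ∃ c : ι → ℝ, (∀ i, 0 ≤ c i) ∧ ∑ i, c i ≤ 1 ∧ ∑ i, c i • v i = y := by
  classical
  constructor
  · intro hy
    refine originSimplex_subset (C := {y | ∃ c : ι → ℝ, (∀ i, 0 ≤ c i) ∧ ∑ i, c i ≤ 1 ∧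
      ∑ i, c i • v i = y}) ?_ ⟨0, by simp⟩ (fun i => ⟨Pi.single i 1, ?_⟩) hy
    · rintro _ ⟨c, hc, hc1, rfl⟩ _ ⟨d, hd, hd1, rfl⟩ a b ha hb hab
      refine ⟨fun i => a * c i + b * d i, fun i => ?_, ?_, ?_⟩
      · have := hc i
        have := hd i
        positivity
      · rw [Finset.sum_add_distrib, ← Finset.mul_sum, ← Finset.mul_sum]
        calc a * ∑ i, c i + b * ∑ i, d i ≤ a * 1 + b * 1 := by gcongr
          _ = 1 := by linarith
      · simp only [add_smul, mul_smul, Finset.sum_add_distrib, Finset.smul_sum]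
    · refine ⟨fun j => ?_, by simp, ?_⟩
      · by_cases h : j = i
        · subst h
          simp
        · simp [h]
      · rw [Finset.sum_eq_single i] <;> simp +contextual
  · rintro ⟨c, hc, hc1, rfl⟩
    have := (convex_originSimplex v).sum_mem (t := Finset.univ)
      (w := fun o : Option ι => o.elim (1 - ∑ i, c i) c) (z := fun o => o.elim 0 v) ?_ ?_ ?_
    · simpa [Fintype.sum_option] using this
    · rintro (_ | i) -
      · simpa using hc1
      · exact hc i
    · simp [Fintype.sum_option]
    · rintro (_ | i) -
      · exact zero_mem_originSimplex v
      · exact mem_originSimplex_self v i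

theorem image_originSimplex {F : Type*} [AddCommGroup F] [Module ℝ F] (f : E →ₗ[ℝ] F)
    (v : ι → E) : f '' originSimplex v = originSimplex (f ∘ v) := by
  rw [originSimplex, originSimplex, f.image_convexHull, Set.image_insert_eq, map_zero,
    Set.range_comp]

theorem originSimplex_comp_equiv (e : κ ≃ ι) (v : ι → E) :
    originSimplex (v ∘ e) = originSimplex v := by
  rw [originSimplex, originSimplex, e.surjective.range_comp]

/-- A linear functional with prescribed values on a linearly independent family. -/
theorem LinearIndependent.exists_linearMap_apply_eq {v : ι → E} (hv : LinearIndependent ℝ v)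
    (c : ι → ℝ) : ∃ l : E →ₗ[ℝ] ℝ, ∀ i, l (v i) = c i := by
  obtain ⟨l, hl⟩ := LinearMap.exists_extend
    (Finsupp.linearCombination ℝ c ∘ₗ hv.linearCombinationEquiv.symm.toLinearMap)
  refine ⟨l, fun i => ?_⟩
  have h := LinearMap.congr_fun hl (hv.linearCombinationEquiv (Finsupp.single i 1))
  simpa using h

theorem LinearIndependent.update_edge [DecidableEq ι] {v : ι → E} {i j : ι} {a b : ℝ}
    (hv : LinearIndependent ℝ v) (hij : i ≠ j)
    (hb : b ≠ 0) :
    LinearIndependent ℝ (Function.update v j (a • v i + b • v j)) := by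
  refine hv.update j _ ⟨1, one_mem _, Finsupp.single i a + Finsupp.single j b, ?_, ?_⟩
  · simpa [Finsupp.single_apply, hij] using hb
  · simp

variable [Fintype ι] {v : ι → E} {i j : ι} {a b : ℝ} {l : E →ₗ[ℝ] ℝ}

theorem Fintype.sum_eq_sum_of_pair {M : Type*} [AddCommGroup M] {f g : ι → M} (hij : i ≠ j)
    (h : f i + f j = g i + g j) (hk : ∀ k, k ≠ i → k ≠ j → f k = g k) :
    ∑ k, f k = ∑ k, g k := by
  rw [← sub_eq_zero, ← Finset.sum_sub_distrib, Fintype.sum_eq_add i j hij]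
  · rw [sub_add_sub_comm, h, sub_self]
  · rintro k ⟨h1, h2⟩
    rw [hk k h1 h2, sub_self]

theorem linearMap_sum_smul (hij : i ≠ j) (hi : l (v i) = b) (hj : l (v j) = -a)
    (hk : ∀ k, k ≠ i → k ≠ j → l (v k) = 0) (c : ι → ℝ) :
    l (∑ k, c k • v k) = c i * b - c j * a := by
  rw [map_sum, Fintype.sum_eq_add i j hij]
  · simp only [map_smul, smul_eq_mul, hi, hj]
    ring
  · rintro k ⟨h1, h2⟩
    simp [hk k h1 h2]

variable [DecidableEq ι]

theorem originSimplex_inter_halfspace (hij : i ≠ j) (ha : 0 < a) (hb : 0 < b) (hab : a + b = 1)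
    (hi : l (v i) = b) (hj : l (v j) = -a) (hk : ∀ k, k ≠ i → k ≠ j → l (v k) = 0) :
    originSimplex v ∩ {y | 0 ≤ l y}
      = originSimplex (Function.update v j (a • v i + b • v j)) := by
  apply Set.Subset.antisymm
  · rintro y ⟨hy, hly⟩
    obtain ⟨c, hc, hc1, rfl⟩ := mem_originSimplex.1 hy
    rw [Set.mem_ofPred_eq, linearMap_sum_smul hij hi hj hk] at hly
    refine mem_originSimplex.2 ⟨Function.update (Function.update c i (c i - c j * a / b)) j
      (c j / b), fun k => ?_, ?_, ?_⟩
    · rcases eq_or_ne k j with rfl | hkj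
      · rw [Function.update_self]
        exact div_nonneg (hc _) hb.le
      · rw [Function.update_of_ne hkj]
        rcases eq_or_ne k i with rfl | hki
        · rw [Function.update_self, sub_nonneg, div_le_iff₀ hb]
          linarith
        · rw [Function.update_of_ne hki]
          exact hc k
    · refine le_of_eq_of_le (Fintype.sum_eq_sum_of_pair hij ?_ fun k h1 h2 => ?_) hc1
      · rw [Function.update_self, Function.update_of_ne hij, Function.update_self]
        field_simp
        linear_combination (-c j) * hab
      · rw [Function.update_of_ne h2, Function.update_of_ne h1]
    · refine Fintype.sum_eq_sum_of_pair hij ?_ fun k h1 h2 => ?_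
      · simp only [Function.update_self, Function.update_of_ne hij, smul_add, smul_smul,
          div_mul_cancel₀ _ hb.ne', sub_smul]
        rw [div_mul_eq_mul_div]
        abel
      · simp only [Function.update_of_ne h2, Function.update_of_ne h1]
  · refine originSimplex_subset ?_ ?_ ?_
    · exact (convex_originSimplex v).inter (convex_halfSpace_ge l.isLinear 0)
    · exact ⟨zero_mem_originSimplex v, (map_zero l).ge⟩
    · intro k
      rcases eq_or_ne k j with rfl | hkj
      · rw [Function.update_self]
        refine ⟨convex_originSimplex v (mem_originSimplex_self v i) (mem_originSimplex_self v _)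
          ha.le hb.le hab, ?_⟩
        simp only [Set.mem_ofPred_eq, map_add, map_smul, smul_eq_mul, hi, hj]
        linarith
      · rw [Function.update_of_ne hkj]
        refine ⟨mem_originSimplex_self v k, ?_⟩
        rcases eq_or_ne k i with rfl | hki
        · exact hb.le.trans_eq hi.symm
        · exact (hk k hki hkj).ge

theorem originSimplex_inter_halfspace_neg (hij : i ≠ j) (ha : 0 < a) (hb : 0 < b)
    (hab : a + b = 1) (hi : l (v i) = b) (hj : l (v j) = -a)
    (hk : ∀ k, k ≠ i → k ≠ j → l (v k) = 0) :
    originSimplex v ∩ {y | l y ≤ 0}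
      = originSimplex (Function.update v i (a • v i + b • v j)) := by
  have := originSimplex_inter_halfspace (v := v) (l := -l) hij.symm hb ha (by linarith)
    (by simp [hj]) (by simp [hi]) (fun k h1 h2 => by simp [hk k h2 h1])
  rw [add_comm, ← this]
  ext
  simp

theorem originSimplex_inter_hyperplane (hij : i ≠ j) (ha : 0 < a) (hb : 0 < b)
    (hab : a + b = 1) (hi : l (v i) = b) (hj : l (v j) = -a)
    (hk : ∀ k, k ≠ i → k ≠ j → l (v k) = 0) :
    originSimplex v ∩ {y | l y = 0} = originSimplex
      fun k : {k // k ≠ j} => Function.update v i (a • v i + b • v j) k := by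
  have hlw : l (a • v i + b • v j) = 0 := by
    rw [map_add, map_smul, map_smul, hi, hj, smul_eq_mul, smul_eq_mul]
    ring
  apply Set.Subset.antisymm
  · rintro y ⟨hy, hly⟩
    have hy2 : y ∈ originSimplex (Function.update v i (a • v i + b • v j)) := by
      rw [← originSimplex_inter_halfspace_neg hij ha hb hab hi hj hk]
      exact ⟨hy, (show l y = 0 from hly).le⟩
    obtain ⟨c, hc, hc1, rfl⟩ := mem_originSimplex.1 hy2
    have hcj : c j = 0 := by
      have hly' : l (∑ k, c k • Function.update v i (a • v i + b • v j) k) = 0 := hly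
      rw [map_sum, Fintype.sum_eq_single j, Function.update_of_ne hij.symm, map_smul, hj,
        smul_eq_mul] at hly'
      · simpa [ha.ne'] using hly'
      · intro k hkj
        rcases eq_or_ne k i with rfl | hki
        · rw [Function.update_self, map_smul, hlw, smul_zero]
        · rw [Function.update_of_ne hki, map_smul, hk k hki hkj, smul_zero]
    rw [Fintype.sum_eq_add_sum_subtype_ne _ j, hcj, zero_add] at hc1
    refine mem_originSimplex.2 ⟨fun k => c k, fun k => hc k, hc1, ?_⟩
    rw [Fintype.sum_eq_add_sum_subtype_ne _ j, hcj, zero_smul, zero_add]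
  · refine originSimplex_subset ?_ ?_ ?_
    · exact (convex_originSimplex v).inter (convex_hyperplane l.isLinear 0)
    · exact ⟨zero_mem_originSimplex v, map_zero l⟩
    · rintro ⟨k, hkj⟩
      rcases eq_or_ne k i with rfl | hki
      · simp only [Function.update_self]
        exact ⟨convex_originSimplex v (mem_originSimplex_self v _) (mem_originSimplex_self v _)
          ha.le hb.le hab, hlw⟩
      · simp only [Function.update_of_ne hki]
        exact ⟨mem_originSimplex_self v k, hk k hki hkj⟩

end OriginSimplex

section SimplexVanishing

variable {n : ℕ}

theorem isPolytope0_originSimplex {ι : Type*} [Fintype ι] (v : ι → Euc n) :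
    IsPolytope0 (originSimplex v) := by
  classical
  exact ⟨⟨insert 0 (Finset.univ.image v), by simp [originSimplex]⟩, zero_mem_originSimplex v⟩

/-- Additivity under cutting polytopes by hyperplanes through the origin. -/
def IsCutAdditive (D : Set (Euc n) → Euc n → ℝ) : Prop :=
  ∀ P, IsPolytope0 P → ∀ (l : Euc n →ₗ[ℝ] ℝ) (x : Euc n),
    D P x + D (P ∩ {y | l y = 0}) x = D (P ∩ {y | 0 ≤ l y}) x + D (P ∩ {y | l y ≤ 0}) x

variable {D : Set (Euc n) → Euc n → ℝ} {p : ℝ}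

theorem IsCutAdditive.cut_originSimplex (hD : IsCutAdditive D) {ι : Type*} [Fintype ι]
    [DecidableEq ι] {v : ι → Euc n} (hv : LinearIndependent ℝ v) {i j : ι} (hij : i ≠ j)
    {a b : ℝ} (ha : 0 < a) (hb : 0 < b) (hab : a + b = 1) (x : Euc n) :
    D (originSimplex v) x + D (originSimplex
        fun k : {k // k ≠ j} => Function.update v i (a • v i + b • v j) k) x
      = D (originSimplex (Function.update v j (a • v i + b • v j))) x
        + D (originSimplex (Function.update v i (a • v i + b • v j))) x := by
  obtain ⟨l, hl⟩ := hv.exists_linearMap_apply_eq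
    (Function.update (Function.update 0 i b) j (-a))
  have hi : l (v i) = b := by rw [hl, Function.update_of_ne hij, Function.update_self]
  have hj : l (v j) = -a := by rw [hl, Function.update_self]
  have hk : ∀ k, k ≠ i → k ≠ j → l (v k) = 0 := fun k h1 h2 => by
    rw [hl, Function.update_of_ne h2, Function.update_of_ne h1, Pi.zero_apply]
  have := hD _ (isPolytope0_originSimplex v) l x
  rwa [originSimplex_inter_halfspace hij ha hb hab hi hj hk,
    originSimplex_inter_halfspace_neg hij ha hb hab hi hj hk,
    originSimplex_inter_hyperplane hij ha hb hab hi hj hk] at this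

theorem IsStronglyCovariant.apply_originSimplex (hD : IsStronglyCovariant D) {ι : Type*} [Fintype ι]
    (hι : Fintype.card ι < n) {v w : ι → Euc n} (hv : LinearIndependent ℝ v)
    (hw : LinearIndependent ℝ w) {x x' : Euc n} (hx : ∀ i, ⟪x, w i⟫ = ⟪x', v i⟫) :
    D (originSimplex w) x = D (originSimplex v) x' := by
  obtain ⟨f, hf, hfv⟩ := exists_det_eq_one_map_eq hv hw (by rwa [finrank_euclideanSpace_fin])
  have hcomp : f ∘ v = w := funext hfv
  rw [← hcomp, ← image_originSimplex]
  refine hD f hf _ (isPolytope0_originSimplex v) x x' fun y hy => ?_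
  obtain ⟨c, -, -, rfl⟩ := mem_originSimplex.1 hy
  simp only [map_sum, map_smul, inner_sum, inner_smul_right, hfv, hx]

theorem LinearIndependent.exists_inner_eq {ι : Type*} {v : ι → Euc n}
    (hv : LinearIndependent ℝ v) (c : ι → ℝ) : ∃ x : Euc n, ∀ i, ⟪x, v i⟫ = c i := by
  obtain ⟨l, hl⟩ := hv.exists_linearMap_apply_eq c
  exact ⟨(InnerProductSpace.toDual ℝ (Euc n)).symm (LinearMap.toContinuousLinearMap l),
    fun i => by rw [InnerProductSpace.toDual_symm_apply, ← hl]; rfl⟩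

/-- If a cut-additive functional vanishes on simplices with one vertex less, then it is additive
under cutting simplices through an edge. -/
theorem IsCutAdditive.cut_originSimplex_of_eq_zero (hcut : IsCutAdditive D)
    {ι : Type} [Fintype ι] [DecidableEq ι]
    (ih : ∀ (κ : Type) [Fintype κ], Fintype.card κ + 1 = Fintype.card ι → ∀ w : κ → Euc n,
      LinearIndependent ℝ w → ∀ x, D (originSimplex w) x = 0)
    {v : ι → Euc n} (hv : LinearIndependent ℝ v) {i j : ι} (hij : i ≠ j)
    {a b : ℝ} (ha : 0 < a) (hb : 0 < b) (hab : a + b = 1) (x : Euc n) :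
    ∃ w, ⟪x, w⟫ = a * ⟪x, v i⟫ + b * ⟪x, v j⟫ ∧ LinearIndependent ℝ (Function.update v i w) ∧
      LinearIndependent ℝ (Function.update v j w) ∧ D (originSimplex v) x
        = D (originSimplex (Function.update v i w)) x
          + D (originSimplex (Function.update v j w)) x := by
  have hv2 := hv.update_edge hij.symm (a := b) ha.ne'
  rw [add_comm] at hv2
  refine ⟨a • v i + b • v j, by rw [inner_add_right, inner_smul_right, inner_smul_right], hv2,
    hv.update_edge hij hb.ne', ?_⟩
  have h := hcut.cut_originSimplex hv hij ha hb hab x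
  have h3 := ih {k // k ≠ j} (by
    have := Fintype.card_pos_iff.2 ⟨j⟩
    rw [Fintype.card_subtype_compl, Fintype.card_subtype_eq]
    omega) _ (hv2.comp _ Subtype.val_injective) x
  simp only [Function.comp_def] at h3
  rw [h3] at h
  linarith

/-- A cut-additive covariant functional vanishing on simplices with one vertex less vanishes on
simplices at vectors taking the same value at two vertices. -/
theorem eq_zero_of_inner_eq (hcut : IsCutAdditive D) (hcov : IsStronglyCovariant D)
    {ι : Type} [Fintype ι] (hι : Fintype.card ι < n)
    (ih : ∀ (κ : Type) [Fintype κ], Fintype.card κ + 1 = Fintype.card ι → ∀ w : κ → Euc n,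
      LinearIndependent ℝ w → ∀ x, D (originSimplex w) x = 0)
    {v : ι → Euc n} (hv : LinearIndependent ℝ v) {i j : ι} (hij : i ≠ j) {x : Euc n}
    (hx : ⟪x, v i⟫ = ⟪x, v j⟫) : D (originSimplex v) x = 0 := by
  classical
  obtain ⟨w, hw, hvi, hvj, h⟩ :=
    hcut.cut_originSimplex_of_eq_zero ih hv hij (a := 1 / 2) (b := 1 / 2)
    (by norm_num) (by norm_num) (by norm_num) x
  have hxw : ⟪x, w⟫ = ⟪x, v j⟫ := by
    rw [hw, hx]
    ring
  have h1 := hcov.apply_originSimplex hι hvj hv (x := x) (x' := x) fun k => by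
    rcases eq_or_ne k j with rfl | hk
    · rw [Function.update_self, hxw]
    · rw [Function.update_of_ne hk]
  have h2 := hcov.apply_originSimplex hι hvi hv (x := x) (x' := x) fun k => by
    rcases eq_or_ne k i with rfl | hk
    · rw [Function.update_self, hxw, hx]
    · rw [Function.update_of_ne hk]
  linarith

theorem exists_convex_combination_eq {s t r : ℝ} (hs : s < r) (ht : r < t) :
    ∃ a b : ℝ, 0 < a ∧ 0 < b ∧ a + b = 1 ∧ a * s + b * t = r := by
  refine ⟨(t - r) / (t - s), (r - s) / (t - s), by apply div_pos <;> linarith,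
    by apply div_pos <;> linarith, ?_, ?_⟩
  all_goals
    have : t - s ≠ 0 := by linarith
    field_simp
    ring

theorem originSimplex_eq_zero_of_card_two (hcut : IsCutAdditive D) (hcov : IsStronglyCovariant D)
    (hsmul : ∀ P, IsPolytope0 P → ∀ c : ℝ, 0 ≤ c → ∀ x, D P (c • x) = c ^ p * D P x)
    (htwo : ∀ v : Fin 2 → Euc n, LinearIndependent ℝ v → ∀ x, ⟪x, v 0⟫ = 0 → |⟪x, v 1⟫| = 1 →
      D (originSimplex v) x = 0)
    {ι : Type} [Fintype ι] (hι : Fintype.card ι < n) (hι2 : Fintype.card ι = 2)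
    (ih : ∀ (κ : Type) [Fintype κ], Fintype.card κ + 1 = Fintype.card ι → ∀ w : κ → Euc n,
      LinearIndependent ℝ w → ∀ x, D (originSimplex w) x = 0)
    {v : ι → Euc n} (hv : LinearIndependent ℝ v) (x : Euc n) : D (originSimplex v) x = 0 := by
  classical
  have hzero : ∀ w : ι → Euc n, LinearIndependent ℝ w → ∀ i j, i ≠ j → ∀ x, ⟪x, w i⟫ = 0 →
      D (originSimplex w) x = 0 := by
    intro w hw i j hij x hx
    rcases eq_or_ne ⟪x, w j⟫ 0 with hj | hj
    · exact eq_zero_of_inner_eq hcut hcov hι ih hw hij (hx.trans hj.symm)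
    have hinj : Function.Injective ![i, j] := by
      intro k k' hk
      fin_cases k <;> fin_cases k' <;> simp_all
    set e : Fin 2 ≃ ι := Equiv.ofBijective ![i, j]
      ((Fintype.bijective_iff_injective_and_card _).2 ⟨hinj, by simp [hι2]⟩) with he
    have h := htwo (w ∘ e) (hw.comp e e.injective) (|⟪x, w j⟫|⁻¹ • x)
      (by simp [he, inner_smul_left, hx]) (by simp [he, inner_smul_left, abs_mul, hj])
    rw [originSimplex_comp_equiv, hsmul _ (isPolytope0_originSimplex w) _ (by positivity)] at h
    exact (mul_eq_zero.1 h).resolve_left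
      (Real.rpow_pos_of_pos (inv_pos.2 (abs_pos.2 hj)) p).ne'
  have hsame : ∀ i j, i ≠ j → ∀ b : ℝ, 0 < b → b < 1 → ⟪x, v i⟫ = b * ⟪x, v j⟫ →
      D (originSimplex v) x = 0 := by
    intro i j hij b hb0 hb1 hx
    have huniv : ∀ k, k = i ∨ k = j := by
      intro k
      by_contra! hk
      have : 2 < Fintype.card ι := Fintype.two_lt_card_iff.2 ⟨k, i, j, hk.1, hk.2, hij⟩
      omega
    obtain ⟨x', hx'⟩ := hv.exists_inner_eq (Function.update 0 j ⟪x, v j⟫)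
    have hxi : ⟪x', v i⟫ = 0 := by rw [hx', Function.update_of_ne hij, Pi.zero_apply]
    have hxj : ⟪x', v j⟫ = ⟪x, v j⟫ := by rw [hx', Function.update_self]
    obtain ⟨w, hw, hvi, hvj, h⟩ := hcut.cut_originSimplex_of_eq_zero ih hv hij (a := 1 - b) (b := b)
      (by linarith) hb0 (by linarith) x'
    rw [hxi, mul_zero, zero_add, hxj, ← hx] at hw
    rw [hzero v hv i j hij x' hxi, hzero _ hvj i j hij x' (by rwa [Function.update_of_ne hij]),
      add_zero] at h
    rw [h]
    refine hcov.apply_originSimplex hι hvi hv fun k => ?_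
    rcases huniv k with rfl | rfl
    · rw [Function.update_self, hw]
    · rw [Function.update_of_ne hij.symm, hxj]
  have hlt : ∀ i j, ⟪x, v i⟫ < ⟪x, v j⟫ → D (originSimplex v) x = 0 := by
    intro i j h
    have hij : i ≠ j := by
      rintro rfl
      exact lt_irrefl _ h
    rcases lt_trichotomy ⟪x, v i⟫ 0 with hi | hi | hi
    · rcases lt_trichotomy ⟪x, v j⟫ 0 with hj | hj | hj
      · refine hsame j i hij.symm (⟪x, v j⟫ / ⟪x, v i⟫) (div_pos_of_neg_of_neg hj hi) ?_ ?_
        · rw [div_lt_one_of_neg hi]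
          exact h
        · rw [div_mul_cancel₀ _ hi.ne]
      · exact hzero v hv j i hij.symm x hj
      · obtain ⟨a, b, ha, hb, hab, hab0⟩ := exists_convex_combination_eq hi hj
        obtain ⟨w, hw, hvi, hvj, h⟩ := hcut.cut_originSimplex_of_eq_zero ih hv hij ha hb hab x
        rw [hab0] at hw
        rw [h, hzero _ hvi i j hij x (by rwa [Function.update_self]),
          hzero _ hvj j i hij.symm x (by rwa [Function.update_self]), add_zero]
    · exact hzero v hv i j hij x hi
    · refine hsame i j hij (⟪x, v i⟫ / ⟪x, v j⟫) (div_pos hi (hi.trans h)) ?_ ?_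
      · rwa [div_lt_one (hi.trans h)]
      · rw [div_mul_cancel₀ _ (hi.trans h).ne']
  obtain ⟨i, j, hij⟩ := Fintype.one_lt_card_iff.1 (by omega : 1 < Fintype.card ι)
  rcases lt_trichotomy ⟪x, v i⟫ ⟪x, v j⟫ with h | h | h
  · exact hlt i j h
  · exact eq_zero_of_inner_eq hcut hcov hι ih hv hij h
  · exact hlt j i h

theorem originSimplex_eq_zero_of_two_lt_card (hcut : IsCutAdditive D)
    (hcov : IsStronglyCovariant D) {ι : Type} [Fintype ι] (hι : Fintype.card ι < n)
    (hι2 : 2 < Fintype.card ι)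
    (ih : ∀ (κ : Type) [Fintype κ], Fintype.card κ + 1 = Fintype.card ι → ∀ w : κ → Euc n,
      LinearIndependent ℝ w → ∀ x, D (originSimplex w) x = 0)
    {v : ι → Euc n} (hv : LinearIndependent ℝ v) (x : Euc n) : D (originSimplex v) x = 0 := by
  classical
  have hmid : ∀ i k j, ⟪x, v i⟫ < ⟪x, v k⟫ → ⟪x, v k⟫ < ⟪x, v j⟫ →
      D (originSimplex v) x = 0 := by
    intro i k j hik hkj
    have hij : i ≠ j := by
      rintro rfl
      exact lt_irrefl _ (hik.trans hkj)
    have hik' : i ≠ k := by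
      rintro rfl
      exact lt_irrefl _ hik
    have hkj' : k ≠ j := by
      rintro rfl
      exact lt_irrefl _ hkj
    obtain ⟨a, b, ha, hb, hab, hab0⟩ := exists_convex_combination_eq hik hkj
    obtain ⟨w, hw, hvi, hvj, h⟩ := hcut.cut_originSimplex_of_eq_zero ih hv hij ha hb hab x
    rw [hab0] at hw
    rw [h, eq_zero_of_inner_eq hcut hcov hι ih hvi hik' (x := x),
      eq_zero_of_inner_eq hcut hcov hι ih hvj hkj'.symm (x := x), add_zero]
    · rw [Function.update_self, Function.update_of_ne hkj', hw]
    · rw [Function.update_self, Function.update_of_ne hik'.symm, hw]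
  have heq : ∀ i j, i ≠ j → ⟪x, v i⟫ = ⟪x, v j⟫ → D (originSimplex v) x = 0 :=
    fun i j hij h => eq_zero_of_inner_eq hcut hcov hι ih hv hij h
  obtain ⟨i, j, k, hij, hik, hjk⟩ := Fintype.two_lt_card_iff.1 hι2
  rcases lt_trichotomy ⟪x, v i⟫ ⟪x, v j⟫ with h1 | h1 | h1
  · rcases lt_trichotomy ⟪x, v j⟫ ⟪x, v k⟫ with h2 | h2 | h2
    · exact hmid i j k h1 h2
    · exact heq j k hjk h2
    · rcases lt_trichotomy ⟪x, v i⟫ ⟪x, v k⟫ with h3 | h3 | h3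
      · exact hmid i k j h3 h2
      · exact heq i k hik h3
      · exact hmid k i j h3 h1
  · exact heq i j hij h1
  · rcases lt_trichotomy ⟪x, v j⟫ ⟪x, v k⟫ with h2 | h2 | h2
    · rcases lt_trichotomy ⟪x, v i⟫ ⟪x, v k⟫ with h3 | h3 | h3
      · exact hmid j i k h1 h3
      · exact heq i k hik h3
      · exact hmid j k i h2 h3
    · exact heq j k hjk h2
    · exact hmid k j i h2 h1

/-- A homogeneous cut-additive covariant functional vanishing on segments and, at vectors
orthogonal to one of the edges, on triangles, vanishes on lower-dimensional simplices. -/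
theorem originSimplex_eq_zero (hp : p ≠ 0) (hcut : IsCutAdditive D) (hcov : IsStronglyCovariant D)
    (hsmul : ∀ P, IsPolytope0 P → ∀ c : ℝ, 0 ≤ c → ∀ x, D P (c • x) = c ^ p * D P x)
    (hone : ∀ v : Fin 1 → Euc n, LinearIndependent ℝ v → ∀ x, |⟪x, v 0⟫| = 1 →
      D (originSimplex v) x = 0)
    (htwo : ∀ v : Fin 2 → Euc n, LinearIndependent ℝ v → ∀ x, ⟪x, v 0⟫ = 0 → |⟪x, v 1⟫| = 1 →
      D (originSimplex v) x = 0) {m : ℕ} (hm : m < n) :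
    ∀ (ι : Type) [Fintype ι], Fintype.card ι = m → ∀ v : ι → Euc n, LinearIndependent ℝ v →
      ∀ x, D (originSimplex v) x = 0 := by
  have hzero : ∀ P, IsPolytope0 P → D P 0 = 0 := by
    intro P hP
    have := hsmul P hP 0 le_rfl 0
    rwa [zero_smul, Real.zero_rpow hp, zero_mul] at this
  induction m with
  | zero =>
    intro ι _ hι v hv x
    have := Fintype.card_eq_zero_iff.1 hι
    rw [hcov.apply_originSimplex (by omega) hv hv (x' := 0) fun i => isEmptyElim i,
      hzero _ (isPolytope0_originSimplex v)]
  | succ m ih =>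
    intro ι _ hι v hv x
    have ih' : ∀ (κ : Type) [Fintype κ], Fintype.card κ + 1 = Fintype.card ι → ∀ w : κ → Euc n,
        LinearIndependent ℝ w → ∀ x, D (originSimplex w) x = 0 :=
      fun κ _ hκ => ih (by omega) κ (by omega)
    rcases lt_trichotomy (Fintype.card ι) 2 with h | h | h
    · have e := Fintype.equivFinOfCardEq (show Fintype.card ι = 1 by omega)
      have huniq : ∀ i, i = e.symm 0 := fun i => by
        rw [← e.symm_apply_apply i, Subsingleton.elim (e i) 0]
      rcases eq_or_ne ⟪x, v (e.symm 0)⟫ 0 with hx | hx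
      · rw [hcov.apply_originSimplex (by omega) hv hv (x' := 0) fun i => by
          rw [huniq i, hx, inner_zero_left], hzero _ (isPolytope0_originSimplex v)]
      · have h := hone (v ∘ e.symm) (hv.comp _ e.symm.injective) (|⟪x, v (e.symm 0)⟫|⁻¹ • x)
          (by simp [inner_smul_left, abs_mul, hx])
        rw [originSimplex_comp_equiv, hsmul _ (isPolytope0_originSimplex v) _ (by positivity)] at h
        exact (mul_eq_zero.1 h).resolve_left
          (Real.rpow_pos_of_pos (inv_pos.2 (abs_pos.2 hx)) p).ne'
    · exact originSimplex_eq_zero_of_card_two hcut hcov hsmul htwo (by omega) h ih' hv x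
    · exact originSimplex_eq_zero_of_two_lt_card hcut hcov (by omega) h ih' hv x

end SimplexVanishing

section Cones

variable {V : Type*} [AddCommGroup V] [Module ℝ V]

/-- The closed half-space on which a linear functional is nonnegative. -/
def halfspaceCone (l : V →ₗ[ℝ] ℝ) : PointedCone ℝ V := (PointedCone.positive ℝ ℝ).comap l

theorem mem_halfspaceCone {l : V →ₗ[ℝ] ℝ} {y : V} : y ∈ halfspaceCone l ↔ 0 ≤ l y := by
  rw [halfspaceCone, PointedCone.mem_comap, PointedCone.mem_positive]

theorem PointedCone.hull_induction {S : Set V} {q : V → Prop} (mem : ∀ y ∈ S, q y) (zero : q 0)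
    (hadd : ∀ y z, q y → q z → q (y + z)) (smul : ∀ c : ℝ, 0 ≤ c → ∀ y, q y → q (c • y))
    {y : V} (hy : y ∈ PointedCone.hull ℝ S) : q y :=
  Submodule.span_induction mem zero (fun y z _ _ => hadd y z) (fun c y _ => smul c c.2 y) hy

theorem PointedCone.fg_inf_halfspaceCone {K : PointedCone ℝ V} (hK : K.FG) (l : V →ₗ[ℝ] ℝ) :
    (K ⊓ halfspaceCone l).FG := by
  classical
  obtain ⟨S, rfl⟩ := hK
  set A := S.filter fun s => 0 ≤ l s with hA
  set B := S.filter fun s => l s < 0 with hB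
  set T := A ∪ Finset.image₂ (fun a b => l a • b - l b • a) A B with hT
  have hAS : ∀ a ∈ A, a ∈ S ∧ 0 ≤ l a := fun a ha => Finset.mem_filter.1 ha
  have hBS : ∀ b ∈ B, b ∈ S ∧ l b < 0 := fun a ha => Finset.mem_filter.1 ha
  refine ⟨T, le_antisymm ?_ ?_⟩
  · refine Submodule.span_le.2 fun y hy => ?_
    rcases Finset.mem_union.1 hy with h | h
    · exact ⟨Submodule.subset_span (hAS y h).1, mem_halfspaceCone.2 (hAS y h).2⟩
    · obtain ⟨a, ha, b, hb, rfl⟩ := Finset.mem_image₂.1 h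
      obtain ⟨haS, ha⟩ := hAS a ha
      obtain ⟨hbS, hb⟩ := hBS b hb
      refine ⟨?_, mem_halfspaceCone.2 ?_⟩
      · rw [sub_eq_add_neg, ← neg_smul]
        exact add_mem (PointedCone.smul_mem _ ha (Submodule.subset_span hbS))
          (PointedCone.smul_mem _ (by linarith) (Submodule.subset_span haS))
      · rw [map_sub, map_smul, map_smul, smul_eq_mul, smul_eq_mul]
        linarith [mul_comm (l a) (l b)]
  · rintro y ⟨hy, hly⟩
    rw [SetLike.mem_coe, mem_halfspaceCone] at hly
    have hsplit : y ∈ PointedCone.hull ℝ (A : Set V) ⊔ PointedCone.hull ℝ (B : Set V) := by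
      rw [← Submodule.span_union, ← Finset.coe_union]
      have : A ∪ B = S := by
        ext s
        simp only [hA, hB, Finset.mem_union, Finset.mem_filter, ← and_or_left]
        exact and_iff_left (le_or_gt 0 (l s))
      rwa [this]
    obtain ⟨a, ha, b, hb, rfl⟩ := Submodule.mem_sup.1 hsplit
    have hAT : PointedCone.hull ℝ (A : Set V) ≤ PointedCone.hull ℝ (T : Set V) :=
      Submodule.span_mono (by simp [hT])
    have hpair : l a • b - l b • a ∈ PointedCone.hull ℝ (T : Set V) := by
      refine PointedCone.hull_induction (q := fun a => l a • b - l b • a ∈ _) (fun a ha => ?_)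
        (by simp) (fun y z hy hz => ?_) (fun c hc y hy => ?_) ha
      · refine PointedCone.hull_induction (q := fun b => l a • b - l b • a ∈ _) (fun b hb => ?_)
          (by simp) (fun y z hy hz => ?_) (fun c hc y hy => ?_) hb
        · exact Submodule.subset_span
            (Finset.mem_union_right _ (Finset.mem_image₂_of_mem ha hb))
        · convert add_mem hy hz using 1
          rw [map_add]
          module
        · convert PointedCone.smul_mem _ hc hy using 1
          rw [map_smul, smul_eq_mul]
          module
      · convert add_mem hy hz using 1
        rw [map_add]
        module
      · convert PointedCone.smul_mem _ hc hy using 1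
        rw [map_smul, smul_eq_mul]
        module
    have hla : 0 ≤ l a := PointedCone.hull_induction (q := fun a => 0 ≤ l a)
      (fun a ha => (hAS a ha).2) (by simp)
      (fun y z hy hz => by rw [map_add]; exact add_nonneg hy hz)
      (fun c hc y hy => by rw [map_smul]; exact mul_nonneg hc hy) ha
    have hlb : b = 0 ∨ l b < 0 := by
      refine PointedCone.hull_induction (q := fun b => b = 0 ∨ l b < 0)
        (fun b hb => .inr (hBS b hb).2) (.inl rfl) ?_ ?_ hb
      · rintro y z (rfl | hy) (rfl | hz)
        · simp
        · simp [hz]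
        · simp [hy]
        · exact .inr (by rw [map_add]; exact add_neg hy hz)
      · rintro c hc y (rfl | hy)
        · simp
        · rcases hc.eq_or_lt with rfl | hc
          · simp
          · exact .inr (by rw [map_smul]; exact mul_neg_of_pos_of_neg hc hy)
    rcases hlb with rfl | hlb
    · rw [add_zero]
      exact hAT ha
    · rw [map_add] at hly
      have hla : 0 < l a := by linarith
      have : a + b = (l a)⁻¹ • (l a • b - l b • a) + ((l a)⁻¹ * (l a + l b)) • a := by
        rw [smul_sub, smul_smul, smul_smul, mul_add, inv_mul_cancel₀ hla.ne']
        module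
      rw [this]
      exact add_mem (PointedCone.smul_mem _ (by positivity) hpair)
        (PointedCone.smul_mem _ (by positivity) (hAT ha))

/-- Weyl's theorem: a finitely generated cone in a finite-dimensional space is a finite
intersection of half-spaces. -/
theorem PointedCone.exists_finset_mem_iff_of_fg [FiniteDimensional ℝ V] {K : PointedCone ℝ V}
    (hK : K.FG) : ∃ A : Finset (V →ₗ[ℝ] ℝ), ∀ y, y ∈ K ↔ ∀ f ∈ A, 0 ≤ f y := by
  classical
  obtain ⟨S, rfl⟩ := hK
  induction S using Finset.induction_on with
  | empty =>
    let b := Module.finBasis ℝ V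
    refine ⟨Finset.univ.image b.coord ∪ Finset.univ.image fun i => -b.coord i, fun y => ?_⟩
    rw [Finset.coe_empty, Submodule.span_empty, Submodule.mem_bot]
    constructor
    · rintro rfl f -
      rw [map_zero]
    · intro h
      refine b.ext_elem fun i => ?_
      have h1 := h (b.coord i) (by simp)
      have h2 := h (-b.coord i) (by simp)
      simp only [Module.Basis.coord_apply, LinearMap.neg_apply] at h1 h2
      simp only [map_zero, Finsupp.zero_apply]
      linarith
  | insert v S _ ih =>
    obtain ⟨A, hA⟩ := ih
    set B := A.filter fun f => 0 ≤ f v with hB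
    set C := A.filter fun f => f v < 0 with hC
    refine ⟨B ∪ Finset.image₂ (fun f g => f v • g - g v • f) B C, fun y => ?_⟩
    rw [Finset.coe_insert, Submodule.span_insert, Submodule.mem_sup]
    constructor
    · rintro ⟨_, hz, w, hw, rfl⟩ f hf
      obtain ⟨t, rfl⟩ := Submodule.mem_span_singleton.1 hz
      have hw := (hA w).1 hw
      have ht : t • v = (t : ℝ) • v := rfl
      have ht0 : 0 ≤ (t : ℝ) := t.2
      rw [ht]
      rcases Finset.mem_union.1 hf with hf | hf
      · obtain ⟨hfA, hf⟩ := Finset.mem_filter.1 hf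
        rw [map_add, map_smul, smul_eq_mul]
        exact add_nonneg (mul_nonneg ht0 hf) (hw f hfA)
      · obtain ⟨f, hfB, g, hgC, rfl⟩ := Finset.mem_image₂.1 hf
        obtain ⟨hfA, hf⟩ := Finset.mem_filter.1 hfB
        obtain ⟨hgA, hg⟩ := Finset.mem_filter.1 hgC
        simp only [LinearMap.sub_apply, LinearMap.smul_apply, map_add, map_smul, smul_eq_mul]
        nlinarith [mul_nonneg hf (hw g hgA), mul_nonneg (neg_nonneg.2 hg.le) (hw f hfA)]
    · intro h
      set U := insert 0 (C.image fun g => g y / g v) with hU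
      have hUne : U.Nonempty := Finset.insert_nonempty _ _
      set t := U.max' hUne with ht
      have ht0 : 0 ≤ t := U.le_max' 0 (Finset.mem_insert_self _ _)
      refine ⟨t • v, PointedCone.smul_mem _ ht0 (Submodule.mem_span_singleton_self v),
        y - t • v, (hA _).2 fun f hf => ?_, by abel⟩
      rw [map_sub, map_smul, smul_eq_mul]
      rcases le_or_gt 0 (f v) with hfv | hfv
      · have hfB : f ∈ B := Finset.mem_filter.2 ⟨hf, hfv⟩
        rcases Finset.mem_insert.1 (U.max'_mem hUne) with h0 | h0
        · rw [← ht] at h0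
          rw [h0]
          linarith [h f (Finset.mem_union_left _ hfB)]
        · obtain ⟨g, hg, hgt⟩ := Finset.mem_image.1 h0
          have hgv := (Finset.mem_filter.1 hg).2
          have := h _ (Finset.mem_union_right _ (Finset.mem_image₂_of_mem hfB hg))
          simp only [LinearMap.sub_apply, LinearMap.smul_apply, smul_eq_mul] at this
          rw [← ht] at hgt
          rw [← hgt, sub_nonneg, div_mul_eq_mul_div, div_le_iff_of_neg hgv]
          linarith
      · have := U.le_max' (f y / f v) (Finset.mem_insert_of_mem
          (Finset.mem_image_of_mem _ (Finset.mem_filter.2 ⟨hf, hfv⟩)))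
        rw [div_le_iff_of_neg hfv] at this
        linarith

end Cones

section ConeValuations

variable {V : Type*} [AddCommGroup V] [Module ℝ V]

/-- A finitely generated cone on which the functional `g` is positive away from the origin. -/
def IsPositiveFG (g : V →ₗ[ℝ] ℝ) (K : PointedCone ℝ V) : Prop :=
  K.FG ∧ ∀ k ∈ K, k ≠ 0 → 0 < g k

variable {g : V →ₗ[ℝ] ℝ} {K : PointedCone ℝ V} {v : V}

theorem IsPositiveFG.inf_halfspaceCone (hK : IsPositiveFG g K) (l : V →ₗ[ℝ] ℝ) :
    IsPositiveFG g (K ⊓ halfspaceCone l) :=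
  ⟨PointedCone.fg_inf_halfspaceCone hK.1 l, fun k hk => hK.2 k hk.1⟩

theorem isPositiveFG_hull {s : Set V} (hs : s.Finite) (hg : ∀ v ∈ s, 0 < g v) :
    IsPositiveFG g (PointedCone.hull ℝ s) := by
  refine ⟨Submodule.fg_span hs, fun k hk => or_iff_not_imp_left.1 ?_⟩
  refine PointedCone.hull_induction (q := fun k => k = 0 ∨ 0 < g k) (fun y hy => .inr (hg y hy))
    (.inl rfl) ?_ ?_ hk
  · rintro y z (rfl | hy) (rfl | hz)
    · simp
    · simp [hz]
    · simp [hy]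
    · exact .inr (by rw [map_add]; exact add_pos hy hz)
  · rintro c hc y (rfl | hy)
    · simp
    · rcases hc.eq_or_lt with rfl | hc
      · simp
      · exact .inr (by rw [map_smul]; exact mul_pos hc hy)

/-- The cone spanned by a vector and a cone. -/
def coneJoin (v : V) (K : PointedCone ℝ V) : PointedCone ℝ V := PointedCone.hull ℝ {v} ⊔ K

theorem mem_coneJoin {y : V} :
    y ∈ coneJoin v K ↔ ∃ t : ℝ, 0 ≤ t ∧ ∃ k ∈ K, t • v + k = y := by
  rw [coneJoin, Submodule.mem_sup]
  constructor
  · rintro ⟨_, hz, k, hk, rfl⟩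
    obtain ⟨t, rfl⟩ := Submodule.mem_span_singleton.1 hz
    exact ⟨t, t.2, k, hk, rfl⟩
  · rintro ⟨t, ht, k, hk, rfl⟩
    exact ⟨t • v, PointedCone.smul_mem _ ht (Submodule.mem_span_singleton_self v), k, hk, rfl⟩

theorem self_mem_coneJoin : v ∈ coneJoin v K :=
  mem_coneJoin.2 ⟨1, zero_le_one, 0, zero_mem _, by simp⟩

theorem IsPositiveFG.coneJoin (hK : IsPositiveFG g K) (hv : 0 < g v) :
    IsPositiveFG g (coneJoin v K) := by
  obtain ⟨⟨S, rfl⟩, hS⟩ := hK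
  have : _root_.coneJoin v (Submodule.span _ (S : Set V))
      = PointedCone.hull ℝ (insert v ((S : Set V) \ {0})) := by
    rw [_root_.coneJoin, PointedCone.hull, PointedCone.hull, Submodule.span_insert,
      Submodule.span_sdiff_singleton_zero]
  rw [this]
  refine isPositiveFG_hull ((S.finite_toSet.sdiff).insert _) ?_
  rintro w (rfl | hw)
  · exact hv
  · exact hS w (Submodule.subset_span hw.1) hw.2

theorem coneJoin_inf_halfspaceCone {l : V →ₗ[ℝ] ℝ} (hl : l v = 0) :
    coneJoin v K ⊓ halfspaceCone l = coneJoin v (K ⊓ halfspaceCone l) := by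
  ext y
  simp only [Submodule.mem_inf, mem_coneJoin, mem_halfspaceCone]
  constructor
  · rintro ⟨⟨t, ht, k, hk, rfl⟩, hy⟩
    rw [map_add, map_smul, hl, smul_zero, zero_add] at hy
    exact ⟨t, ht, k, ⟨hk, hy⟩, rfl⟩
  · rintro ⟨t, ht, k, ⟨hk, hy⟩, rfl⟩
    refine ⟨⟨t, ht, k, hk, rfl⟩, ?_⟩
    rwa [map_add, map_smul, hl, smul_zero, zero_add]

/-- Cuts of a cone in a hyperplane not containing `v` come from cuts of its join with `v` by
functionals vanishing at `v`. -/
theorem exists_coneJoin_inf_halfspaceCone {l : V →ₗ[ℝ] ℝ} (hlv : l v = 1)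
    (hK : ∀ k ∈ K, l k = 0) (l' : V →ₗ[ℝ] ℝ) : ∃ f : V →ₗ[ℝ] ℝ, f v = 0 ∧
      coneJoin v (K ⊓ halfspaceCone l') = coneJoin v K ⊓ halfspaceCone f ∧
      coneJoin v (K ⊓ halfspaceCone (-l')) = coneJoin v K ⊓ halfspaceCone (-f) ∧
      coneJoin v (K ⊓ halfspaceCone l' ⊓ halfspaceCone (-l'))
        = coneJoin v K ⊓ halfspaceCone f ⊓ halfspaceCone (-f) := by
  have hf : (l' - l' v • l) v = 0 := by simp [hlv]
  have heq : K ⊓ halfspaceCone l' = K ⊓ halfspaceCone (l' - l' v • l) := by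
    ext y
    simp only [Submodule.mem_inf, mem_halfspaceCone]
    exact and_congr_right fun hy => by simp [hK y hy]
  have heq' : ∀ L ≤ K, L ⊓ halfspaceCone (-l') = L ⊓ halfspaceCone (-(l' - l' v • l)) := by
    intro L hL
    ext y
    simp only [Submodule.mem_inf, mem_halfspaceCone]
    exact and_congr_right fun hy => by simp [hK y (hL hy)]
  refine ⟨l' - l' v • l, hf, ?_, ?_, ?_⟩
  · rw [heq, coneJoin_inf_halfspaceCone hf]
  · rw [heq' K le_rfl, coneJoin_inf_halfspaceCone (by rw [LinearMap.neg_apply, hf, neg_zero])]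
  · rw [heq' _ inf_le_left, heq, coneJoin_inf_halfspaceCone hf,
      coneJoin_inf_halfspaceCone (by rw [LinearMap.neg_apply, hf, neg_zero])]

/-- The set `A` of functionals describes how far one can move from points of `K` in
direction `-v`. -/
def IsDepthSet (v : V) (K : PointedCone ℝ V) (A : Finset (V →ₗ[ℝ] ℝ)) : Prop :=
  (∀ f ∈ A, f v = 1 ∧ ∀ y ∈ K, 0 ≤ f y) ∧ ∀ y ∈ K, ∀ t : ℝ, (∀ f ∈ A, t ≤ f y) → y - t • v ∈ K

theorem IsPositiveFG.exists_isDepthSet [FiniteDimensional ℝ V] (hK : IsPositiveFG g K)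
    (hv : v ∈ K) (hv0 : v ≠ 0) : ∃ A, A.Nonempty ∧ IsDepthSet v K A := by
  classical
  obtain ⟨B, hB⟩ := PointedCone.exists_finset_mem_iff_of_fg hK.1
  refine ⟨(B.filter fun f => 0 < f v).image fun f => (f v)⁻¹ • f, ?_, ?_, ?_⟩
  · rw [Finset.image_nonempty, Finset.nonempty_iff_ne_empty]
    intro h
    have hneg : -v ∈ K := (hB _).2 fun f hf => by
      have := Finset.filter_eq_empty_iff.1 h hf
      rw [map_neg]
      linarith
    have h1 := hK.2 v hv hv0
    have h2 := hK.2 (-v) hneg (neg_ne_zero.2 hv0)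
    rw [map_neg] at h2
    linarith
  · intro f hf
    obtain ⟨f, hfm, rfl⟩ := Finset.mem_image.1 hf
    obtain ⟨hfB, hf⟩ := Finset.mem_filter.1 hfm
    refine ⟨inv_mul_cancel₀ hf.ne', fun y hy => ?_⟩
    exact mul_nonneg (inv_nonneg.2 hf.le) ((hB y).1 hy f hfB)
  · intro y hy t ht
    refine (hB _).2 fun f hf => ?_
    rw [map_sub, map_smul, smul_eq_mul, sub_nonneg]
    rcases ((hB v).1 hv f hf).eq_or_lt with h | h
    · rw [← h, mul_zero]
      exact (hB y).1 hy f hf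
    · have := ht _ (Finset.mem_image_of_mem _ (Finset.mem_filter.2 ⟨hf, h⟩))
      rwa [LinearMap.smul_apply, smul_eq_mul, inv_mul_eq_div, le_div_iff₀ h] at this

theorem IsDepthSet.inf [DecidableEq (V →ₗ[ℝ] ℝ)] {A : Finset (V →ₗ[ℝ] ℝ)} (hA : IsDepthSet v K A)
    {f₁ f₂ : V →ₗ[ℝ] ℝ} (hf₂ : f₂ ∈ A) (hne : f₂ ≠ f₁) {L : PointedCone ℝ V}
    (hL : ∀ y ∈ L, ∀ t : ℝ, y - t • v ∈ L) (hle : ∀ y ∈ L, f₂ y ≤ f₁ y) :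
    IsDepthSet v (K ⊓ L) (A.erase f₁) := by
  refine ⟨fun f hf => ⟨(hA.1 f (Finset.mem_of_mem_erase hf)).1, fun y hy =>
    (hA.1 f (Finset.mem_of_mem_erase hf)).2 y hy.1⟩, fun y hy t ht => ⟨hA.2 y hy.1 t ?_,
    hL y hy.2 t⟩⟩
  intro f hf
  rcases eq_or_ne f f₁ with rfl | h
  · exact (ht f₂ (Finset.mem_erase.2 ⟨hne, hf₂⟩)).trans (hle y hy.2)
  · exact ht f (Finset.mem_erase.2 ⟨h, hf⟩)

theorem IsDepthSet.eq_coneJoin {f : V →ₗ[ℝ] ℝ} (hf : IsDepthSet v K {f}) (hv : v ∈ K) :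
    K = coneJoin v (K ⊓ halfspaceCone f ⊓ halfspaceCone (-f)) := by
  ext y
  simp only [mem_coneJoin, Submodule.mem_inf, mem_halfspaceCone, LinearMap.neg_apply]
  obtain ⟨hfv, hfK⟩ := hf.1 f (Finset.mem_singleton_self f)
  constructor
  · intro hy
    refine ⟨f y, hfK y hy, y - f y • v, ⟨⟨hf.2 y hy (f y) (by simp), ?_⟩, ?_⟩, by abel⟩
    all_goals simp [hfv]
  · rintro ⟨t, ht, k, ⟨⟨hk, -⟩, -⟩, rfl⟩
    exact add_mem (PointedCone.smul_mem _ ht hv) hk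

/-- Pulling triangulation: a functional of cones that is additive under cuts through `v` and
vanishes on the cones that are pyramids with apex `v` vanishes on all cones containing `v`. -/
theorem eq_zero_of_coneJoin_eq_zero [FiniteDimensional ℝ V] (W : Submodule ℝ V)
    {δ : PointedCone ℝ V → ℝ}
    (hval : ∀ K, IsPositiveFG g K → (∀ k ∈ K, k ∈ W) → v ∈ K → ∀ l : V →ₗ[ℝ] ℝ, l v = 0 →
      δ K + δ (K ⊓ halfspaceCone l ⊓ halfspaceCone (-l))
        = δ (K ⊓ halfspaceCone l) + δ (K ⊓ halfspaceCone (-l)))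
    (hpyr : ∀ l : V →ₗ[ℝ] ℝ, l v = 1 → ∀ K, IsPositiveFG g K → (∀ k ∈ K, k ∈ W ∧ l k = 0) →
      δ (coneJoin v K) = 0)
    (hK : IsPositiveFG g K) (hKW : ∀ k ∈ K, k ∈ W) (hv : v ∈ K) (hv0 : v ≠ 0) : δ K = 0 := by
  classical
  obtain ⟨A, hne, hA⟩ := hK.exists_isDepthSet hv hv0
  obtain ⟨m, hm⟩ : ∃ m, A.card = m + 1 := Nat.exists_eq_succ_of_ne_zero hne.card_ne_zero
  clear hne
  induction m generalizing K A with
  | zero =>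
    obtain ⟨f, rfl⟩ := Finset.card_eq_one.1 hm
    rw [hA.eq_coneJoin hv]
    refine hpyr f (hA.1 f (by simp)).1 _ ((hK.inf_halfspaceCone f).inf_halfspaceCone (-f))
      fun k hk => ⟨hKW k hk.1.1, ?_⟩
    have h1 := mem_halfspaceCone.1 hk.1.2
    have h2 := mem_halfspaceCone.1 hk.2
    rw [LinearMap.neg_apply] at h2
    linarith
  | succ m ih =>
    obtain ⟨f₁, hf₁, f₂, hf₂, hne⟩ := Finset.one_lt_card.1 (by omega : 1 < A.card)
    have hl : (f₁ - f₂) v = 0 := by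
      rw [LinearMap.sub_apply, (hA.1 f₁ hf₁).1, (hA.1 f₂ hf₂).1, sub_self]
    have hl' : (-(f₁ - f₂)) v = 0 := by rw [LinearMap.neg_apply, hl, neg_zero]
    have hstable : ∀ l : V →ₗ[ℝ] ℝ, l v = 0 → ∀ y ∈ halfspaceCone l, ∀ t : ℝ,
        y - t • v ∈ halfspaceCone l := fun l hl y hy t => by
      rw [mem_halfspaceCone, map_sub, map_smul, hl, smul_zero, sub_zero]
      exact mem_halfspaceCone.1 hy
    have hcard : ∀ f ∈ A, (A.erase f).card = m + 1 := fun f hf => by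
      rw [Finset.card_erase_of_mem hf]
      omega
    have hvl : ∀ l : V →ₗ[ℝ] ℝ, l v = 0 → v ∈ halfspaceCone l := fun l hl =>
      mem_halfspaceCone.2 hl.ge
    have hle : ∀ y ∈ halfspaceCone (f₁ - f₂), f₂ y ≤ f₁ y := fun y hy =>
      sub_nonneg.1 (mem_halfspaceCone.1 hy)
    have hle' : ∀ y ∈ halfspaceCone (-(f₁ - f₂)), f₁ y ≤ f₂ y := fun y hy =>
      sub_nonneg.1 ((mem_halfspaceCone.1 hy).trans_eq (by simp))
    have h1 := ih (hK.inf_halfspaceCone (f₁ - f₂)) (fun k hk => hKW k hk.1) ⟨hv, hvl _ hl⟩ _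
      (hA.inf hf₂ hne.symm (hstable _ hl) hle) (hcard _ hf₁)
    have h2 := ih (hK.inf_halfspaceCone (-(f₁ - f₂))) (fun k hk => hKW k hk.1) ⟨hv, hvl _ hl'⟩ _
      (hA.inf hf₁ hne (hstable _ hl') hle') (hcard _ hf₂)
    have h3 := ih ((hK.inf_halfspaceCone (f₁ - f₂)).inf_halfspaceCone (-(f₁ - f₂)))
      (fun k hk => hKW k hk.1.1) ⟨⟨hv, hvl _ hl⟩, hvl _ hl'⟩ _ (by
        rw [inf_assoc]
        exact hA.inf hf₂ hne.symm
          (fun y hy t => ⟨hstable _ hl y hy.1 t, hstable _ hl' y hy.2 t⟩)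
          fun y hy => hle y hy.1) (hcard _ hf₁)
    have := hval K hK hKW hv _ hl
    rwa [h1, h2, h3, add_zero, add_zero] at this

/-- A functional of cones that is additive under cuts and vanishes on simplicial cones
vanishes. -/
theorem eq_zero_of_hull_eq_zero [FiniteDimensional ℝ V] (W : Submodule ℝ V)
    (δ : PointedCone ℝ V → ℝ)
    (hval : ∀ K, IsPositiveFG g K → (∀ k ∈ K, k ∈ W) → ∀ l : V →ₗ[ℝ] ℝ,
      δ K + δ (K ⊓ halfspaceCone l ⊓ halfspaceCone (-l))
        = δ (K ⊓ halfspaceCone l) + δ (K ⊓ halfspaceCone (-l)))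
    (hsimp : ∀ s : Set V, s.Finite → LinearIndepOn ℝ id s → (∀ v ∈ s, v ∈ W ∧ 0 < g v) →
      δ (PointedCone.hull ℝ s) = 0)
    (hK : IsPositiveFG g K) (hKW : ∀ k ∈ K, k ∈ W) : δ K = 0 := by
  induction hm : Module.finrank ℝ W using Nat.strong_induction_on generalizing W δ K with
  | h m ih =>
  rcases eq_or_ne K ⊥ with rfl | hbot
  · have := hsimp ∅ Set.finite_empty (linearIndepOn_empty ℝ id) (by simp)
    rwa [PointedCone.hull, Submodule.span_empty] at this
  obtain ⟨v, hv, hv0⟩ := Submodule.exists_mem_ne_zero_of_ne_bot hbot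
  have hgv := hK.2 v hv hv0
  have hvW := hKW v hv
  refine eq_zero_of_coneJoin_eq_zero W (fun K hK hKW _ l _ => hval K hK hKW l) ?_ hK hKW hv hv0
  intro l hlv K hK hKl
  have hrank : Module.finrank ℝ (W ⊓ l.ker : Submodule ℝ V) < m := by
    rw [← hm]
    refine Submodule.finrank_lt_finrank_of_lt (lt_of_le_of_ne inf_le_left fun h => ?_)
    have h0 : v ∈ W ⊓ l.ker := by rwa [h]
    have := LinearMap.mem_ker.1 h0.2
    rw [hlv] at this
    exact one_ne_zero this
  refine ih _ hrank (W ⊓ l.ker) (fun K => δ (coneJoin v K)) ?_ ?_ hK hKl rfl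
  · intro K hK hKW l'
    obtain ⟨f, -, h1, h2, h3⟩ :=
      exists_coneJoin_inf_halfspaceCone hlv (fun k hk => (hKW k hk).2) l'
    rw [h1, h2, h3]
    refine hval (coneJoin v K) (hK.coneJoin hgv) (fun k hk => ?_) f
    obtain ⟨t, -, w, hw, rfl⟩ := mem_coneJoin.1 hk
    exact W.add_mem (W.smul_mem t hvW) (hKW w hw).1
  · intro s hs hli hsW
    have : coneJoin v (PointedCone.hull ℝ s) = PointedCone.hull ℝ (insert v s) := by
      rw [coneJoin, ← Submodule.span_insert]
    change δ (coneJoin v (PointedCone.hull ℝ s)) = 0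
    rw [this]
    refine hsimp _ (hs.insert v) (hli.id_insert fun hmem => ?_) ?_
    · have hle : Submodule.span ℝ s ≤ l.ker := Submodule.span_le.2 fun w hw => (hsW w hw).1.2
      have := LinearMap.mem_ker.1 (hle hmem)
      rw [hlv] at this
      exact one_ne_zero this
    · rintro w (rfl | hw)
      · exact ⟨hvW, hgv⟩
      · exact ⟨(hsW w hw).1.1, (hsW w hw).2⟩

end ConeValuations

section Slices

variable {n : ℕ}

/-- The slice at height one of a cone. -/
def slice (K : PointedCone ℝ (Euc n × ℝ)) : Set (Euc n) := {y | (y, (1 : ℝ)) ∈ K}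

theorem mem_slice {K : PointedCone ℝ (Euc n × ℝ)} {y : Euc n} :
    y ∈ slice K ↔ (y, (1 : ℝ)) ∈ K := Iff.rfl

theorem slice_hull {S : Set (Euc n × ℝ)} (hS : ∀ s ∈ S, 0 < s.2) :
    slice (PointedCone.hull ℝ S) = convexHull ℝ ((fun s => s.2⁻¹ • s.1) '' S) := by
  apply Set.Subset.antisymm
  · intro y hy
    have hconv : Convex ℝ (convexHull ℝ ((fun s : Euc n × ℝ => s.2⁻¹ • s.1) '' S)) :=
      convex_convexHull _ _
    have h := PointedCone.hull_induction (q := fun k : Euc n × ℝ => k = 0 ∨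
      (0 < k.2 ∧ k.2⁻¹ • k.1 ∈ convexHull ℝ ((fun s : Euc n × ℝ => s.2⁻¹ • s.1) '' S)))
      (fun s hs => .inr ⟨hS s hs, subset_convexHull ℝ _ ⟨s, hs, rfl⟩⟩) (.inl rfl) ?_ ?_
      (mem_slice.1 hy)
    · rcases h with h | ⟨-, h⟩
      · exact absurd (congrArg Prod.snd h) one_ne_zero
      · simpa using h
    · rintro k k' (rfl | ⟨hk, hk'⟩) (rfl | ⟨hl, hl'⟩)
      · simp
      · exact .inr (by simpa using ⟨hl, hl'⟩)
      · exact .inr (by simpa using ⟨hk, hk'⟩)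
      · refine .inr ⟨add_pos hk hl, ?_⟩
        have := hconv hk' hl' (a := k.2 / (k.2 + k'.2)) (b := k'.2 / (k.2 + k'.2))
          (by positivity) (by positivity) (by field_simp)
        convert this using 1
        rw [smul_smul, smul_smul, div_mul_eq_mul_div, div_mul_eq_mul_div,
          mul_inv_cancel₀ hk.ne', mul_inv_cancel₀ hl.ne', ← smul_add, one_div]
        rfl
    · rintro c hc k (rfl | ⟨hk, hk'⟩)
      · simp
      · rcases hc.eq_or_lt with rfl | hc
        · simp
        · refine .inr ⟨mul_pos hc hk, ?_⟩
          convert hk' using 1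
          rw [Prod.smul_fst, Prod.smul_snd, smul_smul, smul_eq_mul, _root_.mul_inv_rev, mul_assoc,
            inv_mul_cancel₀ hc.ne', mul_one]
  · refine convexHull_min ?_ ?_
    · rintro _ ⟨s, hs, rfl⟩
      have := PointedCone.smul_mem (PointedCone.hull ℝ S) (inv_nonneg.2 (hS s hs).le)
        (Submodule.subset_span hs)
      rw [mem_slice]
      convert this using 1
      ext1
      · rfl
      · exact (inv_mul_cancel₀ (hS s hs).ne').symm
    · intro y hy z hz a b ha hb hab
      rw [mem_slice]
      convert add_mem (PointedCone.smul_mem _ ha (mem_slice.1 hy))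
        (PointedCone.smul_mem _ hb (mem_slice.1 hz)) using 1
      ext1
      · rfl
      · simp [hab]

theorem isPolytope0_slice {K : PointedCone ℝ (Euc n × ℝ)}
    (hK : IsPositiveFG (LinearMap.snd ℝ (Euc n) ℝ) K) (h0 : ((0 : Euc n), (1 : ℝ)) ∈ K) :
    IsPolytope0 (slice K) := by
  classical
  obtain ⟨⟨S, rfl⟩, hS⟩ := hK
  refine ⟨⟨(S.erase 0).image fun s => s.2⁻¹ • s.1, ?_⟩, h0⟩
  rw [Finset.coe_image, Finset.coe_erase, ← slice_hull, PointedCone.hull,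
    Submodule.span_sdiff_singleton_zero]
  exact fun s hs => hS s (Submodule.subset_span hs.1) hs.2

theorem IsPolytope0.exists_slice_eq {P : Set (Euc n)} (hP : IsPolytope0 P) :
    ∃ K : PointedCone ℝ (Euc n × ℝ), IsPositiveFG (LinearMap.snd ℝ (Euc n) ℝ) K ∧
      (∀ k ∈ K, k.1 ∈ Submodule.span ℝ P) ∧ slice K = P := by
  obtain ⟨⟨S, rfl⟩, -⟩ := hP
  have hpos : ∀ s ∈ (fun y : Euc n => (y, (1 : ℝ))) '' S, 0 < s.2 := by
    rintro _ ⟨y, -, rfl⟩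
    exact one_pos
  refine ⟨PointedCone.hull ℝ ((fun y : Euc n => (y, (1 : ℝ))) '' S),
    isPositiveFG_hull (S.finite_toSet.image _) hpos, fun k hk => ?_, ?_⟩
  · refine PointedCone.hull_induction (q := fun k => k.1 ∈ Submodule.span ℝ _) ?_
      (Submodule.zero_mem _) (fun y z hy hz => Submodule.add_mem _ hy hz)
      (fun c _ y hy => Submodule.smul_mem _ c hy) hk
    rintro _ ⟨y, hy, rfl⟩
    exact Submodule.subset_span (subset_convexHull ℝ _ hy)
  · rw [slice_hull hpos, Set.image_image]
    simp

theorem slice_inf_halfspaceCone {K : PointedCone ℝ (Euc n × ℝ)} {l : Euc n × ℝ →ₗ[ℝ] ℝ}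
    (hl : l (0, 1) = 0) : slice (K ⊓ halfspaceCone l)
      = slice K ∩ {y | 0 ≤ (l ∘ₗ LinearMap.inl ℝ (Euc n) ℝ) y} := by
  ext y
  have : l (y, 1) = l (y, 0) := by
    simpa [hl] using map_add l (y, 0) (0, 1)
  simp [mem_slice, mem_halfspaceCone, this]

theorem IsPolytope0.inter_halfspace {P : Set (Euc n)} (hP : IsPolytope0 P)
    (l : Euc n →ₗ[ℝ] ℝ) : IsPolytope0 (P ∩ {y | 0 ≤ l y}) := by
  obtain ⟨K, hK, -, rfl⟩ := hP.exists_slice_eq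
  have h := slice_inf_halfspaceCone (K := K) (l := l ∘ₗ LinearMap.fst ℝ (Euc n) ℝ) (by simp)
  rw [LinearMap.comp_assoc, LinearMap.fst_comp_inl, LinearMap.comp_id] at h
  rw [← h]
  exact isPolytope0_slice (hK.inf_halfspaceCone _)
    ⟨mem_slice.1 hP.zero_mem, mem_halfspaceCone.2 (by simp)⟩

theorem setOf_neg_nonneg (l : Euc n →ₗ[ℝ] ℝ) : {y | 0 ≤ (-l) y} = {y | l y ≤ 0} := by
  simp

theorem inter_setOf_eq_zero (P : Set (Euc n)) (l : Euc n →ₗ[ℝ] ℝ) :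
    P ∩ {y | l y = 0} = P ∩ {y | 0 ≤ l y} ∩ {y | l y ≤ 0} := by
  rw [Set.inter_assoc]
  congr 1
  ext y
  exact eq_comm.trans le_antisymm_iff

theorem IsPolytope0.inter_halfspace_neg {P : Set (Euc n)} (hP : IsPolytope0 P)
    (l : Euc n →ₗ[ℝ] ℝ) : IsPolytope0 (P ∩ {y | l y ≤ 0}) := by
  rw [← setOf_neg_nonneg]
  exact hP.inter_halfspace (-l)

theorem IsPolytope0.inter_hyperplane {P : Set (Euc n)} (hP : IsPolytope0 P)
    (l : Euc n →ₗ[ℝ] ℝ) : IsPolytope0 (P ∩ {y | l y = 0}) := by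
  rw [inter_setOf_eq_zero]
  exact (hP.inter_halfspace l).inter_halfspace_neg l

theorem IsCutAdditive.slice_cut {D : Set (Euc n) → Euc n → ℝ} (hD : IsCutAdditive D)
    {K : PointedCone ℝ (Euc n × ℝ)} (hK : IsPositiveFG (LinearMap.snd ℝ (Euc n) ℝ) K)
    (h0 : ((0 : Euc n), (1 : ℝ)) ∈ K) {l : Euc n × ℝ →ₗ[ℝ] ℝ} (hl : l (0, 1) = 0)
    (x : Euc n) :
    D (slice K) x + D (slice (K ⊓ halfspaceCone l ⊓ halfspaceCone (-l))) x
      = D (slice (K ⊓ halfspaceCone l)) x + D (slice (K ⊓ halfspaceCone (-l))) x := by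
  have hl' : (-l) (0, 1) = 0 := by rw [LinearMap.neg_apply, hl, neg_zero]
  have h := hD _ (isPolytope0_slice hK h0) (l ∘ₗ LinearMap.inl ℝ (Euc n) ℝ) x
  rw [slice_inf_halfspaceCone hl', slice_inf_halfspaceCone hl', slice_inf_halfspaceCone hl,
    LinearMap.neg_comp, setOf_neg_nonneg, ← inter_setOf_eq_zero]
  exact h

theorem slice_coneJoin_hull {s : Set (Euc n × ℝ)} (hs : ∀ v ∈ s, 0 < v.2) :
    slice (coneJoin ((0 : Euc n), (1 : ℝ)) (PointedCone.hull ℝ s))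
      = originSimplex fun v : s => v.1.2⁻¹ • v.1.1 := by
  rw [coneJoin, ← Submodule.span_union, slice_hull, Set.singleton_union, Set.image_insert_eq,
    originSimplex, smul_zero, Set.image_eq_range]
  rintro v (rfl | hv)
  · exact one_pos
  · exact hs v hv

/-- A cut-additive functional vanishing on simplices of dimension at most `m` vanishes on
polytopes of dimension at most `m`. -/
theorem IsCutAdditive.eq_zero {D : Set (Euc n) → Euc n → ℝ} (hD : IsCutAdditive D) {m : ℕ}
    {x : Euc n} (hsimp : ∀ (ι : Type) [Fintype ι], Fintype.card ι ≤ m → ∀ v : ι → Euc n,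
      LinearIndependent ℝ v → D (originSimplex v) x = 0)
    {P : Set (Euc n)} (hP : IsPolytope0 P) (hdim : sdim P ≤ m) : D P x = 0 := by
  obtain ⟨K, hK, hKP, rfl⟩ := hP.exists_slice_eq
  set Q := slice K
  set u : Euc n × ℝ := (0, 1) with hu
  have hu0 : u ≠ 0 := fun h => one_ne_zero (congrArg Prod.snd h)
  have hgu : 0 < LinearMap.snd ℝ (Euc n) ℝ u := one_pos
  set W : Submodule ℝ (Euc n × ℝ) := (Submodule.span ℝ Q).comap (LinearMap.fst ℝ (Euc n) ℝ)
  refine eq_zero_of_coneJoin_eq_zero (v := u) W (δ := fun K => D (slice K) x)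
    (fun K hK _ hv l hl => hD.slice_cut hK hv hl x) ?_ hK hKP (mem_slice.1 hP.zero_mem) hu0
  intro l hl K' hK' hK'W
  refine eq_zero_of_hull_eq_zero (W ⊓ l.ker) (fun K => D (slice (coneJoin u K)) x) ?_ ?_ hK' hK'W
  · intro L hL hLW l'
    obtain ⟨f, hf, h1, h2, h3⟩ :=
      exists_coneJoin_inf_halfspaceCone hl (fun k hk => (hLW k hk).2) l'
    rw [h1, h2, h3]
    exact hD.slice_cut (hL.coneJoin hgu) self_mem_coneJoin hf x
  · intro s hs hli hsW
    have := hs.fintype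
    have hpos : ∀ v ∈ s, 0 < v.2 := fun v hv => (hsW v hv).2
    have hspan : Submodule.span ℝ s ≤ l.ker := Submodule.span_le.2 fun v hv => (hsW v hv).1.2
    have hdisj : Disjoint (Submodule.span ℝ (Set.range fun v : s => (v : Euc n × ℝ)))
        (LinearMap.fst ℝ (Euc n) ℝ).ker := by
      rw [Subtype.range_coe, Submodule.disjoint_def]
      intro y hy hy1
      have hy2 : y = y.2 • u := by
        ext1
        · simpa [hu] using hy1
        · simp [hu]
      have h0 := LinearMap.mem_ker.1 (hspan hy)
      rw [hy2, map_smul, hl, smul_eq_mul, mul_one] at h0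
      rw [hy2, h0, zero_smul]
    have hli1 : LinearIndependent ℝ fun v : s => v.1.1 :=
      LinearIndependent.map (v := fun v : s => (v : Euc n × ℝ)) (f := LinearMap.fst ℝ (Euc n) ℝ)
        hli hdisj
    have hli2 : LinearIndependent ℝ fun v : s => v.1.2⁻¹ • v.1.1 :=
      hli1.units_smul fun v : s => Units.mk0 v.1.2⁻¹ (inv_ne_zero (hpos v.1 v.2).ne')
    change D (slice (coneJoin u (PointedCone.hull ℝ s))) x = 0
    rw [slice_coneJoin_hull hpos]
    refine hsimp s (le_trans ?_ hdim) _ hli2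
    rw [sdim_eq_finrank_span hP.zero_mem, ← finrank_span_eq_card hli1]
    refine Submodule.finrank_mono (Submodule.span_le.2 ?_)
    rintro _ ⟨v, rfl⟩
    exact (hsW v v.2).1.1

end Slices

section SimplexValues

variable {n : ℕ} {p : ℝ}

theorem supp_eq_zero_of_nonpos {F : Set (Euc n)} (hF : IsCompact F) (h0 : (0 : Euc n) ∈ F)
    {x : Euc n} (h : ∀ y ∈ F, ⟪x, y⟫ ≤ 0) : supp F x = 0 :=
  le_antisymm (supp_le ⟨0, h0⟩ h) (supp_nonneg hF h0 x)

theorem PhiP_eq_zero_of_nonpos (hp : p ≠ 0) (a₁ a₂ : ℝ) {P : Set (Euc n)} (hP : IsPolytope0 P)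
    {x : Euc n} (h : ∀ y ∈ P, ⟪x, y⟫ ≤ 0) : PhiP p a₁ a₂ P x = 0 := by
  have hF : ∀ j, ∀ F ∈ facesO j P, supp F x ^ p = 0 := fun j F hF => by
    rw [supp_eq_zero_of_nonpos (hF.1.isCompact hP.isCompact) hF.2.2
      fun y hy => h y (hF.1.subset hy), Real.zero_rpow hp]
  rw [PhiP, supp_eq_zero_of_nonpos hP.isCompact hP.zero_mem h, Real.zero_rpow hp,
    Finset.sum_eq_zero fun j _ => by rw [finsum_mem_eq_zero_of_forall_eq_zero (hF j), mul_zero]]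
  simp

theorem sdim_originSimplex {ι : Type*} [Fintype ι] {v : ι → Euc n}
    (hv : LinearIndependent ℝ v) : sdim (originSimplex v) = Fintype.card ι := by
  have h : Submodule.span ℝ (originSimplex v) = Submodule.span ℝ (Set.range v) := by
    apply le_antisymm
    · exact Submodule.span_le.2 (originSimplex_subset (Submodule.span ℝ (Set.range v)).convex
        (zero_mem _) fun i => Submodule.subset_span ⟨i, rfl⟩)
    · refine Submodule.span_mono ?_
      rintro _ ⟨i, rfl⟩
      exact mem_originSimplex_self v i
  rw [sdim_eq_finrank_span (zero_mem_originSimplex v), h, finrank_span_eq_card hv]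

theorem inner_originSimplex_le {ι : Type*} {v : ι → Euc n} {x : Euc n} {c : ℝ} (hc : 0 ≤ c)
    (h : ∀ i, ⟪x, v i⟫ ≤ c) : ∀ y ∈ originSimplex v, ⟪x, y⟫ ≤ c :=
  originSimplex_subset (C := {y | ⟪x, y⟫ ≤ c})
    (convex_halfSpace_le (innerₗ (Euc n) x).isLinear c) (by simpa using hc) h

theorem PhiP_originSimplex_one (a₁ a₂ : ℝ) {v : Fin 1 → Euc n} (hv : LinearIndependent ℝ v)
    {x : Euc n} (hx : ⟪x, v 0⟫ = 1) : PhiP p a₁ a₂ (originSimplex v) x = a₁ := by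
  have hs : supp (originSimplex v) x = 1 := by
    refine le_antisymm (supp_le ⟨0, zero_mem_originSimplex v⟩
      (inner_originSimplex_le zero_le_one fun i => ?_)) ?_
    · rw [Subsingleton.elim i 0, hx]
    · rw [← hx]
      exact inner_le_supp (isPolytope0_originSimplex v).isCompact x (mem_originSimplex_self v 0)
  rw [PhiP, sdim_originSimplex hv, hs]
  simp

theorem PhiP_originSimplex_two (hp : p ≠ 0) (a₁ a₂ : ℝ) {v : Fin 2 → Euc n}
    (hv : LinearIndependent ℝ v) {x : Euc n} (hx0 : ⟪x, v 0⟫ = 0) (hx1 : ⟪x, v 1⟫ = 1) :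
    PhiP p a₁ a₂ (originSimplex v) x = a₂ := by
  set T := originSimplex v with hT
  have hTc : IsCompact T := (isPolytope0_originSimplex v).isCompact
  have h0 : (0 : Euc n) ∈ T := zero_mem_originSimplex v
  have hle : ∀ y ∈ T, ⟪x, y⟫ ≤ 1 := inner_originSimplex_le zero_le_one fun i => by
    fin_cases i
    · exact hx0.trans_le zero_le_one
    · exact hx1.le
  have hs : ∀ F ⊆ T, v 1 ∈ F → supp F x = 1 := fun F hF h1 => by
    refine le_antisymm (supp_le ⟨_, h1⟩ fun y hy => hle y (hF hy)) (le_csSup ?_ ⟨v 1, h1, hx1⟩)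
    refine ⟨1, ?_⟩
    rintro _ ⟨y, hy, rfl⟩
    exact hle y (hF hy)
  obtain ⟨l, hl⟩ := hv.exists_linearMap_apply_eq ![-1, 0]
  have hl0 : l (v 0) = -1 := hl 0
  have hl1 : l (v 1) = 0 := hl 1
  have hdecomp : ∀ y ∈ T, ∃ c : Fin 2 → ℝ, (∀ i, 0 ≤ c i) ∧ y = c 0 • v 0 + c 1 • v 1 :=
    fun y hy => by
      obtain ⟨c, hc, -, rfl⟩ := mem_originSimplex.1 hy
      exact ⟨c, hc, Fin.sum_univ_two _⟩
  set F₀ := {y ∈ T | l y = 0} with hF₀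
  have hv1 : v 1 ∈ F₀ := ⟨mem_originSimplex_self v 1, hl1⟩
  have hF₀mem : F₀ ∈ facesO 1 T := by
    have h : F₀ ∈ originFaces T := (mem_originFaces (P := T) h0).2 ⟨l, fun y hy => by
      obtain ⟨c, hc, rfl⟩ := hdecomp y hy
      rw [map_add, map_smul, map_smul, hl0, hl1, smul_eq_mul, smul_eq_mul]
      linarith [hc 0], rfl⟩
    refine ⟨h.1, ?_, h.2⟩
    have hspan : Submodule.span ℝ F₀ = Submodule.span ℝ {v 1} := by
      refine le_antisymm (Submodule.span_le.2 ?_)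
        (Submodule.span_mono (Set.singleton_subset_iff.2 hv1))
      rintro y ⟨hy, hly⟩
      obtain ⟨c, hc, rfl⟩ := hdecomp y hy
      rw [map_add, map_smul, map_smul, hl0, hl1, smul_eq_mul, smul_eq_mul] at hly
      rw [show c 0 = 0 by linarith, zero_smul, zero_add]
      exact Submodule.smul_mem _ _ (Submodule.mem_span_singleton_self _)
    rw [sdim_eq_finrank_span h.2, hspan, finrank_span_singleton (hv.ne_zero 1)]
  have hF : ∀ F ∈ facesO 1 T, F ≠ F₀ → supp F x ^ p = 0 := by
    intro F hF hne
    have hFo : F ∈ originFaces T := ⟨hF.1, hF.2.2⟩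
    obtain ⟨g, hg, hFg⟩ := (mem_originFaces (P := T) h0).1 hFo
    have hg0 := hg _ (mem_originSimplex_self v 0)
    have hg1 := hg _ (mem_originSimplex_self v 1)
    have hgy : ∀ c : Fin 2 → ℝ, g (c 0 • v 0 + c 1 • v 1) = c 0 * g (v 0) + c 1 * g (v 1) :=
      fun c => by rw [map_add, map_smul, map_smul, smul_eq_mul, smul_eq_mul]
    have hly : ∀ c : Fin 2 → ℝ, l (c 0 • v 0 + c 1 • v 1) = -c 0 := fun c => by
      rw [map_add, map_smul, map_smul, hl0, hl1, smul_eq_mul, smul_eq_mul]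
      ring
    rcases hg1.lt_or_eq with hg1 | hg1
    · rw [supp_eq_zero_of_nonpos (hF.1.isCompact hTc) hF.2.2, Real.zero_rpow hp]
      intro y hy
      rw [hFg] at hy
      obtain ⟨hyT, hgy0⟩ := hy
      obtain ⟨c, hc, rfl⟩ := hdecomp y hyT
      rw [hgy] at hgy0
      have h2 : c 1 * g (v 1) = 0 := by
        linarith [mul_nonpos_of_nonneg_of_nonpos (hc 0) hg0,
          mul_nonpos_of_nonneg_of_nonpos (hc 1) hg1.le]
      have h3 : c 1 = 0 := (mul_eq_zero.1 h2).resolve_right hg1.ne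
      rw [inner_add_right, inner_smul_right, inner_smul_right, hx0, h3]
      simp
    · exfalso
      rcases hg0.lt_or_eq with hg0 | hg0
      · refine hne ?_
        rw [hFg]
        ext y
        refine and_congr_right fun hy => ?_
        obtain ⟨c, hc, rfl⟩ := hdecomp y hy
        rw [hgy, hly, hg1, mul_zero, add_zero, mul_eq_zero, or_iff_left hg0.ne, neg_eq_zero]
      · have hFT : F = T := by
          rw [hFg]
          refine Set.sep_eq_self_iff_mem_true.2 fun y hy => ?_
          obtain ⟨c, hc, rfl⟩ := hdecomp y hy
          rw [hgy, hg0, hg1, mul_zero, mul_zero, add_zero]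
        have := hF.2.1
        rw [hFT, sdim_originSimplex hv, Fintype.card_fin] at this
        omega
  have hsum : ∑ᶠ F ∈ facesO 1 T, supp F x ^ p = 1 := by
    have h : ∀ F, F ≠ F₀ → ∑ᶠ _ : F ∈ facesO 1 T, supp F x ^ p = 0 := fun F hne => by
      classical
      rw [finsum_eq_if]
      split_ifs with h
      exacts [hF F h hne, rfl]
    classical
    rw [finsum_eq_single _ F₀ h, finsum_eq_if, if_pos hF₀mem, hs F₀ (fun y hy => hy.1) hv1,
      Real.one_rpow]
  rw [PhiP, sdim_originSimplex hv, hs T subset_rfl (mem_originSimplex_self v 1)]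
  simp only [Fintype.card_fin, Nat.not_odd_iff_even.2 even_two, hsum, Real.one_rpow, if_false,
    Nat.add_one_sub_one, Finset.Icc_self, Finset.sum_singleton]
  ring

end SimplexValues

section Valuations

variable {n : ℕ}

theorem isCutAdditive_of_valuation {Φ : Set (Euc n) → Euc n → ℝ}
    (hval : ∀ K L : Set (Euc n), IsPolytope0 K → IsPolytope0 L → IsPolytope0 (K ∪ L) →
      IsPolytope0 (K ∩ L) → ∀ x : Euc n, Φ (K ∪ L) x + Φ (K ∩ L) x = Φ K x + Φ L x) :
    IsCutAdditive Φ := by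
  intro P hP l x
  have hunion : P ∩ {y | 0 ≤ l y} ∪ P ∩ {y | l y ≤ 0} = P := by
    rw [← Set.inter_union_distrib_left, Set.inter_eq_left]
    exact fun y _ => le_total 0 (l y)
  have hinter : P ∩ {y | 0 ≤ l y} ∩ (P ∩ {y | l y ≤ 0}) = P ∩ {y | l y = 0} := by
    rw [← Set.inter_inter_distrib_left, ← Set.inter_assoc, inter_setOf_eq_zero]
  have := hval _ _ (hP.inter_halfspace l) (hP.inter_halfspace_neg l) (by rwa [hunion])
    (by rw [hinter]; exact hP.inter_hyperplane l) x
  rwa [hunion, hinter] at this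

theorem isCutAdditive_PhiP {p : ℝ} (hp : p ≠ 0) (a₁ a₂ : ℝ) :
    IsCutAdditive (n := n) (PhiP p a₁ a₂) := fun _ hP l x =>
  PhiP_cut hp a₁ a₂ hP l (hP.inter_halfspace l) (hP.inter_halfspace_neg l)
    (hP.inter_hyperplane l) x

theorem exists_linearIndependent_fin {m : ℕ} (hm : m ≤ n) :
    ∃ v : Fin m → Euc n, LinearIndependent ℝ v :=
  ⟨_, (EuclideanSpace.basisFun (Fin n) ℝ).toBasis.linearIndependent.comp (Fin.castLE hm)
    (Fin.castLE_injective hm)⟩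

end Valuations

/-- Lemma 5.8: for `n ≥ 3`, if `Φ : P_o^n → C_p(ℝ^n)` is an `SL(n)` covariant valuation,
then there are constants `a₁, a₂, b₁, b₂ ∈ ℝ` with
`Φ P = Φ_{p;a₁,a₂}(P) + Φ_{p;b₁,b₂}(-P)` for every `P ∈ P_o^n` with `dim P ≤ n - 1`. -/
theorem function_valued_valuation_lower_dimensional (n : ℕ) (hn : 3 ≤ n) (p : ℝ)
    (hp : 1 ≤ p) (Φ : Set (Euc n) → Euc n → ℝ)
    (hCp : ∀ P : Set (Euc n), IsPolytope0 P → Continuous (Φ P) ∧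
      ∀ c : ℝ, 0 ≤ c → ∀ x : Euc n, Φ P (c • x) = c ^ p * Φ P x)
    (hval : ∀ K L : Set (Euc n), IsPolytope0 K → IsPolytope0 L → IsPolytope0 (K ∪ L) →
      IsPolytope0 (K ∩ L) → ∀ x : Euc n,
      Φ (K ∪ L) x + Φ (K ∩ L) x = Φ K x + Φ L x)
    (hcov : ∀ (φ : Matrix.SpecialLinearGroup (Fin n) ℝ) (P : Set (Euc n)), IsPolytope0 P →
      ∀ x : Euc n, Φ (matAct (φ : Matrix (Fin n) (Fin n) ℝ) P) x
        = Φ P (matVec ((φ : Matrix (Fin n) (Fin n) ℝ))ᵀ x)) :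
    ∃ a₁ a₂ b₁ b₂ : ℝ, ∀ P : Set (Euc n), IsPolytope0 P → sdim P ≤ n - 1 →
      ∀ x : Euc n, Φ P x = PhiP p a₁ a₂ P x + PhiP p b₁ b₂ (-P) x := by
  have hp0 : p ≠ 0 := by linarith
  have hΦcut : IsCutAdditive Φ := isCutAdditive_of_valuation hval
  have hΦcov : IsStronglyCovariant Φ := isStronglyCovariant_of_specialLinearGroup (by omega) Φ
    (fun P hP => (hCp P hP).1) hcov
  obtain ⟨v₁, hv₁⟩ := exists_linearIndependent_fin (show 1 ≤ n by omega)
  obtain ⟨v₂, hv₂⟩ := exists_linearIndependent_fin (show 2 ≤ n by omega)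
  obtain ⟨x₁, hx₁⟩ := hv₁.exists_inner_eq ![1]
  obtain ⟨x₂, hx₂⟩ := hv₂.exists_inner_eq ![0, 1]
  set a₁ := Φ (originSimplex v₁) x₁
  set b₁ := Φ (originSimplex v₁) (-x₁)
  set a₂ := Φ (originSimplex v₂) x₂
  set b₂ := Φ (originSimplex v₂) (-x₂)
  set D : Set (Euc n) → Euc n → ℝ :=
    fun P x => Φ P x - PhiP p a₁ a₂ P x - PhiP p b₁ b₂ P (-x) with hD
  have hcut : IsCutAdditive D := fun P hP l x => by
    have h₁ := hΦcut P hP l x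
    have h₂ := isCutAdditive_PhiP hp0 a₁ a₂ P hP l x
    have h₃ := isCutAdditive_PhiP hp0 b₁ b₂ P hP l (-x)
    simp only [hD]
    linarith
  have hDcov : IsStronglyCovariant D := fun f hf P hP x x' hx => by
    simp only [hD]
    rw [hΦcov f hf P hP x x' hx, isStronglyCovariant_PhiP hp0 a₁ a₂ f hf P hP x x' hx,
      isStronglyCovariant_PhiP hp0 b₁ b₂ f hf P hP (-x) (-x')
        fun y hy => by rw [inner_neg_left, inner_neg_left, hx y hy]]
  have hsmul : ∀ P, IsPolytope0 P → ∀ c : ℝ, 0 ≤ c → ∀ x, D P (c • x) = c ^ p * D P x := by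
    intro P hP c hc x
    simp only [hD]
    rw [(hCp P hP).2 c hc x, PhiP_smul a₁ a₂ hP hc, ← smul_neg, PhiP_smul b₁ b₂ hP hc]
    ring
  have hone : ∀ v : Fin 1 → Euc n, LinearIndependent ℝ v → ∀ x, |⟪x, v 0⟫| = 1 →
      D (originSimplex v) x = 0 := by
    intro v hv x hx
    have hP := isPolytope0_originSimplex v
    simp only [hD]
    rcases (abs_eq zero_le_one).1 hx with h | h
    · rw [hΦcov.apply_originSimplex (by simp; omega) hv₁ hv (x' := x₁)
          (fun i => by rw [Subsingleton.elim i 0, h, hx₁]; simp),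
        PhiP_originSimplex_one a₁ a₂ hv h, PhiP_eq_zero_of_nonpos hp0 b₁ b₂ hP
          (inner_originSimplex_le le_rfl fun i => by
            rw [Subsingleton.elim i 0, inner_neg_left, h]; norm_num)]
      ring
    · rw [hΦcov.apply_originSimplex (by simp; omega) hv₁ hv (x' := -x₁)
          (fun i => by rw [Subsingleton.elim i 0, inner_neg_left, h, hx₁]; simp),
        PhiP_originSimplex_one b₁ b₂ hv (by rw [inner_neg_left, h, neg_neg]),
        PhiP_eq_zero_of_nonpos hp0 a₁ a₂ hP (inner_originSimplex_le le_rfl fun i => by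
            rw [Subsingleton.elim i 0, h]; norm_num)]
      ring
  have htwo : ∀ v : Fin 2 → Euc n, LinearIndependent ℝ v → ∀ x, ⟪x, v 0⟫ = 0 →
      |⟪x, v 1⟫| = 1 → D (originSimplex v) x = 0 := by
    intro v hv x hx0 hx
    have hP := isPolytope0_originSimplex v
    simp only [hD]
    rcases (abs_eq zero_le_one).1 hx with h | h
    · rw [hΦcov.apply_originSimplex (by simp; omega) hv₂ hv (x' := x₂)
          (fun i => by rw [hx₂]; fin_cases i <;> simp [hx0, h]),
        PhiP_originSimplex_two hp0 a₁ a₂ hv hx0 h, PhiP_eq_zero_of_nonpos hp0 b₁ b₂ hP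
          (inner_originSimplex_le le_rfl fun i => by fin_cases i <;> simp [hx0, h])]
      ring
    · rw [hΦcov.apply_originSimplex (by simp; omega) hv₂ hv (x' := -x₂)
          (fun i => by rw [inner_neg_left, hx₂]; fin_cases i <;> simp [hx0, h]),
        PhiP_originSimplex_two hp0 b₁ b₂ hv (by rw [inner_neg_left, hx0, neg_zero])
          (by rw [inner_neg_left, h, neg_neg]),
        PhiP_eq_zero_of_nonpos hp0 a₁ a₂ hP
          (inner_originSimplex_le le_rfl fun i => by fin_cases i <;> simp [hx0, h])]
      ring
  refine ⟨a₁, a₂, b₁, b₂, fun P hP hdim x => ?_⟩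
  have h : D P x = 0 := hcut.eq_zero (fun ι _ hι v hv => originSimplex_eq_zero hp0 hcut hDcov
    hsmul hone htwo (by omega) ι rfl v hv x) hP hdim
  rw [PhiP_neg_set hp0 b₁ b₂ hP]
  simp only [hD] at h
  linarith
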